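/- Let M be any model of NFU^{-AC} ∪ {AxCount_≥, ¬AxCount} and let A = {n ∈ ℕ^M : M ⊨ T(n)=n}, where ℕ^M denotes the internal natural numbers of M. Then A contains 0^M and 1^M and is closed under the internal operations +^M and ·^M, so A carries an L_PA-structure 𝒜; moreover, the internal arithmetic (ℕ^M, +^M, ·^M, 0^M, 1^M) of M is a proper elementary end-extension of 𝒜 (𝒜 is a proper elementary L_PA-substructure, and every element of ℕ^M that is ≤^M some element of A belongs to A). -/

import Mathlib

open FirstOrder Language

namespace NFUweak

/-! ## The language L_NFU -/

/-- Function symbols of `L_NFU`: a single binary (type-level) pairing function. -/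
inductive NFUFunc : ℕ → Type
  | pair : NFUFunc 2

/-- Relation symbols of `L_NFU`: binary membership `∈` and unary sethood `S`. -/
inductive NFURel : ℕ → Type
  | mem : NFURel 2
  | isSet : NFURel 1

/-- The language `L_NFU`. -/
def LNFU : Language := ⟨NFUFunc, NFURel⟩

/-- The membership relation symbol. -/
def memR : LNFU.Relations 2 := NFURel.mem

/-- The sethood relation symbol. -/
def setR : LNFU.Relations 1 := NFURel.isSet

/-- The pairing function symbol. -/
def pairF : LNFU.Functions 2 := NFUFunc.pair

/-! ## Stratification -/

/-- `termLevel σ t k` says that, relative to the assignment `σ` of levels (types)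
to variables, the term `t` (and all of its subterms) receives level `k`. -/
def termLevel {α : Type} (σ : α → ℕ) : LNFU.Term α → ℕ → Prop
  | Term.var v, k => σ v = k
  | Term.func _ ts, k => ∀ i, termLevel σ (ts i) k

/-- The stratification condition on an atomic formula `R(ts)`:
for `s ∈ t` the level of `t` is one more than that of `s`; `S(t)` imposes only
that `t` has a well-defined level. -/
def atomOK {α : Type} (σ : α → ℕ) : ∀ {l : ℕ}, LNFU.Relations l → (Fin l → LNFU.Term α) → Prop
  | _, NFURel.mem, ts => ∃ k, termLevel σ (ts 0) k ∧ termLevel σ (ts 1) (k + 1)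
  | _, NFURel.isSet, ts => ∃ k, termLevel σ (ts 0) k

/-- `stratifiedFrom σ φ` : the formula `φ` is stratified, where the free
variables receive the levels given by `σ` (each quantified variable may receive
any level). -/
def stratifiedFrom : ∀ {n : ℕ}, ((Empty ⊕ Fin n) → ℕ) → LNFU.BoundedFormula Empty n → Prop
  | _, _, BoundedFormula.falsum => True
  | _, σ, BoundedFormula.equal t s => ∃ k, termLevel σ t k ∧ termLevel σ s k
  | _, σ, BoundedFormula.rel R ts => atomOK σ R ts
  | _, σ, BoundedFormula.imp f g => stratifiedFrom σ f ∧ stratifiedFrom σ g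
  | _, σ, BoundedFormula.all f =>
      ∃ k, stratifiedFrom
        (Sum.elim (fun e => σ (Sum.inl e)) (Fin.snoc (fun i => σ (Sum.inr i)) k)) f

/-- A formula of `L_NFU` is stratified if some assignment of levels to its
variables witnesses the stratification conditions. -/
def IsStratified {n : ℕ} (φ : LNFU.BoundedFormula Empty n) : Prop :=
  ∃ σ, stratifiedFrom σ φ

/-! ## The axioms of NFU⁻ᴬᶜ -/

/-- Weak extensionality: sets with the same members are equal. -/
def weakExtAx : LNFU.Sentence :=
  ∀' ∀' ((setR.boundedFormula₁ &0 ⊓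
          setR.boundedFormula₁ &1) ⟹
    (Term.bdEqual &0 &1 ⇔
      ∀' (memR.boundedFormula₂ &2 &0 ⇔
          memR.boundedFormula₂ &2 &1)))

/-- The pairing axiom: `⟨x,y⟩ = ⟨w,z⟩ → x = w ∧ y = z`. -/
def pairingAx : LNFU.Sentence :=
  ∀' ∀' ∀' ∀' (Term.bdEqual
      (pairF.apply₂ &0 &1)
      (pairF.apply₂ &2 &3) ⟹
    (Term.bdEqual &0 &2 ⊓ Term.bdEqual &1 &3))

/-- The comprehension axiom for a formula `φ(x, z₀, …, z_{m-1})`, where the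
variable `x` is (de Bruijn) variable `m` of `φ` and `z₀, …, z_{m-1}` are the
parameters: `∀ z⃗ ∃ y (S(y) ∧ ∀ x (x ∈ y ↔ φ(x, z⃗)))`. -/
def comprehensionAx (m : ℕ) (φ : LNFU.BoundedFormula Empty (m + 1)) : LNFU.Sentence :=
  BoundedFormula.alls (∃'
    (setR.boundedFormula₁ (Term.var (Sum.inr ⟨m, by omega⟩)) ⊓
      ∀' (memR.boundedFormula₂
            (Term.var (Sum.inr ⟨m + 1, by omega⟩)) (Term.var (Sum.inr ⟨m, by omega⟩)) ⇔
          φ.liftAt 1 m)))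

/-- The theory NFU⁻ᴬᶜ : weak extensionality, pairing and stratified comprehension. -/
def NFUmAC : LNFU.Theory :=
  {weakExtAx, pairingAx} ∪
    {s | ∃ (m : ℕ) (φ : LNFU.BoundedFormula Empty (m + 1)),
      IsStratified φ ∧ s = comprehensionAx m φ}

/-- The axiom `∀x S(x)` ("everything is a set"), turning NFU⁻ᴬᶜ into NF. -/
def allSetAx : LNFU.Sentence :=
  ∀' (setR.boundedFormula₁ &0)

/-- The theory NF. -/
def NF : LNFU.Theory := NFUmAC ∪ {allSetAx}

end NFUweak
namespace NFUweak

/-! ## Semantic notions inside a model of NFU⁻ᴬᶜ -/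

section Semantics

variable {M : Type} [LNFU.Structure M]

/-- The membership relation of the model. -/
def smem (x y : M) : Prop := Structure.RelMap memR ![x, y]

/-- The sethood predicate of the model. -/
def sset (x : M) : Prop := Structure.RelMap setR ![x]

/-- The (type-level) pairing function of the model. -/
def spair (x y : M) : M := Structure.funMap pairF ![x, y]

/-- `s` is the singleton `{x}`. -/
def isSingletonOf (s x : M) : Prop := sset s ∧ ∀ z, smem z s ↔ z = x

/-- `e` is the empty set. -/
def isEmptySet (e : M) : Prop := sset e ∧ ∀ z, ¬ smem z e

/-- `v` is the universal set `V`. -/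
def isUniverseOf (v : M) : Prop := sset v ∧ ∀ x, smem x v

/-- `f` is an internal function from (the members of) `X` to `Y`, coded as a set of
type-level ordered pairs `⟨a, b⟩`. -/
def isFunc (f X Y : M) : Prop :=
  sset f ∧ (∀ p, smem p f → ∃ a b, p = spair a b ∧ smem a X ∧ smem b Y) ∧
    (∀ a, smem a X → ∃ b, smem (spair a b) f) ∧
    (∀ a b b', smem (spair a b) f → smem (spair a b') f → b = b')

/-- `f` is an internal injection from `X` into `Y`. -/
def isInjFunc (f X Y : M) : Prop :=
  isFunc f X Y ∧ ∀ a a' b, smem (spair a b) f → smem (spair a' b) f → a = a'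

/-- `f` is an internal bijection between `X` and `Y`. -/
def isBijFunc (f X Y : M) : Prop :=
  isInjFunc f X Y ∧ ∀ b, smem b Y → ∃ a, smem (spair a b) f

/-- `X` and `Y` are equipollent (internally). -/
def equipollent (X Y : M) : Prop := ∃ f, isBijFunc f X Y

/-- `c` is the cardinal `|X|`, i.e. the equivalence class of `X` under equipollence. -/
def isCardOf (c X : M) : Prop := sset c ∧ ∀ y, smem y c ↔ equipollent y X

/-- `c` is a cardinal. -/
def isCardinal (c : M) : Prop := ∃ X, sset X ∧ isCardOf c X

/-- `κ ≤ μ` for cardinals: some member of `κ` injects into some member of `μ`. -/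
def cardLe (κ μ : M) : Prop := ∃ X Y f, smem X κ ∧ smem Y μ ∧ isInjFunc f X Y

/-- `Y = ι``X` is the set of singletons of members of `X`. -/
def isIotaImageOf (Y X : M) : Prop :=
  sset Y ∧ ∀ z, smem z Y ↔ ∃ x, smem x X ∧ isSingletonOf z x

/-- `t = T(c)` for a cardinal `c`:  `T(|X|) = |ι``X|`. -/
def isTOf (t c : M) : Prop :=
  ∃ X Y, smem X c ∧ isIotaImageOf Y X ∧ isCardOf t Y

/-- `t = T⁴(c)`. -/
def isT4Of (t c : M) : Prop :=
  ∃ t₁ t₂ t₃, isTOf t₁ c ∧ isTOf t₂ t₁ ∧ isTOf t₃ t₂ ∧ isTOf t t₃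

/-- `z` is the cardinal `0`, the set of all objects with no members. -/
def isZeroCard (z : M) : Prop := sset z ∧ ∀ y, smem y z ↔ ∀ w, ¬ smem w y

/-- `s = S(x)` is the cardinal successor:  `S(x) = {y : (∃z∈y)(y∖{z} ∈ x)}`. -/
def isSuccOf (s x : M) : Prop :=
  sset s ∧ ∀ y, smem y s ↔
    ∃ z, smem z y ∧ ∃ d, sset d ∧ (∀ w, smem w d ↔ (smem w y ∧ w ≠ z)) ∧ smem d x

/-- `o` is the cardinal `1 = S(0)`. -/
def isOneCard (o : M) : Prop := ∃ z, isZeroCard z ∧ isSuccOf o z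

/-- `I` is an inductive set: it contains `0` and is closed under `S`. -/
def isInductiveSet (I : M) : Prop :=
  sset I ∧ (∀ z, isZeroCard z → smem z I) ∧ ∀ a b, smem a I → isSuccOf b a → smem b I

/-- `n` is an internal natural number: it belongs to every inductive set. -/
def isNat (n : M) : Prop := ∀ I, isInductiveSet I → smem n I

/-- `N` is the set `ℕ` of internal natural numbers. -/
def isNatSet (N : M) : Prop := sset N ∧ ∀ y, smem y N ↔ isNat y

/-- `m + k = n` on cardinals, via disjoint unions. -/
def cardAdd (m k n : M) : Prop :=
  ∃ x y u, smem x m ∧ smem y k ∧ (∀ w, ¬ (smem w x ∧ smem w y)) ∧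
    sset u ∧ (∀ w, smem w u ↔ (smem w x ∨ smem w y)) ∧ smem u n

/-- `P` is the cartesian product `x × y` (with type-level pairs). -/
def isProdOf (P x y : M) : Prop :=
  sset P ∧ ∀ p, smem p P ↔ ∃ a b, smem a x ∧ smem b y ∧ p = spair a b

/-- `k · m = n` on cardinals, via cartesian products. -/
def cardMul (k m n : M) : Prop :=
  ∃ x y P, smem x k ∧ smem y m ∧ isProdOf P x y ∧ smem P n

/-- `m ≤ n` on internal natural numbers: `∃k∈ℕ, m + k = n`. -/
def natLe (m n : M) : Prop := ∃ k, isNat k ∧ cardAdd m k n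

/-- The model satisfies `AxCount₍≥₎ : (∀n∈ℕ)(T(n) ≤ n)`. -/
def axCountGeqHolds (M : Type) [LNFU.Structure M] : Prop :=
  ∀ n : M, isNat n → ∀ t, isTOf t n → natLe t n

/-- The model satisfies `AxCount₍≤₎ : (∀n∈ℕ)(n ≤ T(n))`. -/
def axCountLeqHolds (M : Type) [LNFU.Structure M] : Prop :=
  ∀ n : M, isNat n → ∀ t, isTOf t n → natLe n t

/-- The model satisfies `AxCount : (∀n∈ℕ)(T(n) = n)`. -/
def axCountHolds (M : Type) [LNFU.Structure M] : Prop :=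
  ∀ n : M, isNat n → ∀ t, isTOf t n → t = n

/-- The model satisfies the Axiom of Choice: every set of pairwise disjoint
nonempty sets has a transversal. -/
def acHolds (M : Type) [LNFU.Structure M] : Prop :=
  ∀ X : M, sset X →
    (∀ y, smem y X → sset y ∧ ∃ z, smem z y) →
    (∀ y y', smem y X → smem y' X → y ≠ y' → ∀ z, ¬ (smem z y ∧ smem z y')) →
    ∃ t, sset t ∧ ∀ y, smem y X → ∃! z, smem z y ∧ smem z t

/-- `2^κ` is defined (i.e. `2^κ ≠ ∅`): there is a set `X` with `|ι``X| = κ`. -/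
def twoPowDefined (κ : M) : Prop := ∃ X Y, isIotaImageOf Y X ∧ isCardOf κ Y

/-- `P` is the power set of `X`. -/
def isPowerSetOf (P X : M) : Prop :=
  sset P ∧ ∀ z, smem z P ↔ (sset z ∧ ∀ w, smem w z → smem w X)

/-- `μ = 2^κ` (in the nonempty case): `μ = |P(X)|` for some `X` with `|ι``X| = κ`. -/
def isTwoPowOf (μ κ : M) : Prop :=
  ∃ X Y P, isIotaImageOf Y X ∧ isCardOf κ Y ∧ isPowerSetOf P X ∧ isCardOf μ P

/-- `f` is the internal function `beth : ℕ → NC ∪ {∅}` with `beth(0) = ℵ₀` and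
`beth(n+1) = 2^{beth(n)}` (with value `∅` once undefined). -/
def isBethFun (f : M) : Prop :=
  sset f ∧
    (∀ p, smem p f → ∃ n y, isNat n ∧ p = spair n y) ∧
    (∀ n, isNat n → ∃ y, smem (spair n y) f) ∧
    (∀ n y y', smem (spair n y) f → smem (spair n y') f → y = y') ∧
    (∀ z y, isZeroCard z → smem (spair z y) f → ∃ N, isNatSet N ∧ isCardOf y N) ∧
    (∀ n n' y y', isNat n → isSuccOf n' n →
      smem (spair n y) f → smem (spair n' y') f →
        ((isEmptySet y ∧ isEmptySet y') ∨
          (¬ isEmptySet y ∧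
            (isTwoPowOf y' y ∨ (isEmptySet y' ∧ ¬ twoPowDefined y)))))

end Semantics

end NFUweak
namespace NFUweak

/-! ## BFEXTs and the structure ⟨BF, E⟩ inside a model of NFU⁻ᴬᶜ -/

section BF

variable {M : Type} [LNFU.Structure M]

/-- `R` is an internal binary relation: a set of (type-level) ordered pairs. -/
def isRel (R : M) : Prop := sset R ∧ ∀ p, smem p R → ∃ x y, p = spair x y

/-- `x` belongs to the field `Dom(R) = dom(R) ∪ rng(R)` of the relation `R`. -/
def inField (x R : M) : Prop := ∃ y, smem (spair x y) R ∨ smem (spair y x) R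

/-- `D` is the field `Dom(R)` of `R`, as a set. -/
def isFieldSetOf (D R : M) : Prop := sset D ∧ ∀ x, smem x D ↔ inField x R

/-- `R` is a BFEXT: a binary relation that is well-founded (every nonempty
subset of its field has an `R`-minimal element) and extensional. -/
def isBFEXT (R : M) : Prop :=
  isRel R ∧
    (∀ B, sset B → (∃ b, smem b B) → (∀ b, smem b B → inField b R) →
      ∃ b, smem b B ∧ ∀ c, smem c B → ¬ smem (spair c b) R) ∧
    (∀ a b, inField a R → inField b R →
      (∀ c, smem (spair c a) R ↔ smem (spair c b) R) → a = b)

/-- `x` belongs to the smallest subset of `Dom(R)` containing `a` and closed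
under `R`-predecessors. -/
def inSeg (x R a : M) : Prop :=
  ∀ B, sset B → (∀ b, smem b B → inField b R) → smem a B →
    (∀ b c, smem b B → smem (spair c b) R → smem c B) → smem x B

/-- `s = seg_R(a)`: the restriction of `R` to the smallest subset of `Dom(R)`
containing `a` and closed under `R`-predecessors. -/
def isSegOf (s R a : M) : Prop :=
  sset s ∧ ∀ p, smem p s ↔
    (smem p R ∧ ∃ x y, p = spair x y ∧ inSeg x R a ∧ inSeg y R a)

/-- `R ∈ Ω`: `R` is a BFEXT with `R = seg_R(a)` for some `a ∈ Dom(R)`. -/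
def inOmega (R : M) : Prop := isBFEXT R ∧ ∃ a, inField a R ∧ isSegOf R R a

/-- `a = 1_R` is the (unique) top of `R ∈ Ω`. -/
def isTopOf (a R : M) : Prop := inField a R ∧ isSegOf R R a

/-- `f` is an internal isomorphism between the relations `R` and `S`. -/
def isIsoRel (f R S : M) : Prop :=
  sset f ∧
    (∀ p, smem p f → ∃ x y, p = spair x y ∧ inField x R ∧ inField y S) ∧
    (∀ x, inField x R → ∃ y, smem (spair x y) f) ∧
    (∀ x y y', smem (spair x y) f → smem (spair x y') f → y = y') ∧
    (∀ x x' y, smem (spair x y) f → smem (spair x' y) f → x = x') ∧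
    (∀ y, inField y S → ∃ x, smem (spair x y) f) ∧
    (∀ x y x' y', smem (spair x x') f → smem (spair y y') f →
      (smem (spair x y) R ↔ smem (spair x' y') S))

/-- `R` and `S` are isomorphic relations. -/
def relIso (R S : M) : Prop := ∃ f, isIsoRel f R S

/-- `t = [R]` is the set of all relations isomorphic to `R`. -/
def isTypeOf (t R : M) : Prop := sset t ∧ ∀ S, smem S t ↔ relIso S R

/-- `a ∈ BF`: `a = [R]` for some `R ∈ Ω`. -/
def inBF (a : M) : Prop := ∃ R, inOmega R ∧ isTypeOf a R

/-- `a E b` for `a, b ∈ BF`: for `R ∈ a`, `S ∈ b` there is `x ∈ Dom(S)` with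
`⟨x, 1_S⟩ ∈ S` and `R ≅ seg_S(x)`. -/
def erel (a b : M) : Prop :=
  ∃ R S, smem R a ∧ smem S b ∧
    ∃ x oneS, isTopOf oneS S ∧ smem (spair x oneS) S ∧
      ∃ sg, isSegOf sg S x ∧ relIso R sg

/-- `e` is the set `E ⊆ BF × BF`. -/
def isESet (e : M) : Prop :=
  sset e ∧ ∀ p, smem p e ↔ ∃ a b, p = spair a b ∧ inBF a ∧ inBF b ∧ erel a b

/-- `R' = T(R)`: the relation `{⟨{x},{y}⟩ : ⟨x,y⟩ ∈ R}`. -/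
def isTRelOf (R' R : M) : Prop :=
  sset R' ∧ ∀ p, smem p R' ↔
    ∃ x y sx sy, smem (spair x y) R ∧ isSingletonOf sx x ∧ isSingletonOf sy y ∧
      p = spair sx sy

/-- `t' = T(t)` for (isomorphism) types `t` of well-founded relations:
`T([R]) = [{⟨{x},{y}⟩ : ⟨x,y⟩ ∈ R}]`. -/
def isTTypeOf (t' t : M) : Prop :=
  ∃ R R', smem R t ∧ isTRelOf R' R ∧ isTypeOf t' R'

/-- `y = M₀ = E^ω`, the set of types of BFEXTs with finite domain. -/
def isM0Set (y : M) : Prop :=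
  sset y ∧ ∀ a, smem a y ↔
    (inBF a ∧ ∃ R D c, smem R a ∧ isFieldSetOf D R ∧ isCardOf c D ∧ isNat c)

/-- `g` is the internal function `n ↦ M_n = E^{ω+n}` on the internal naturals:
`M_0 = E^ω` and `M_{n+1} = {a ∈ BF : every E-predecessor of a lies in M_n}`. -/
def isMFun (g : M) : Prop :=
  sset g ∧
    (∀ p, smem p g → ∃ n y, isNat n ∧ p = spair n y) ∧
    (∀ n, isNat n → ∃ y, smem (spair n y) g) ∧
    (∀ n y y', smem (spair n y) g → smem (spair n y') g → y = y') ∧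
    (∀ z y, isZeroCard z → smem (spair z y) g → isM0Set y) ∧
    (∀ n n' y y', isNat n → isSuccOf n' n →
      smem (spair n y) g → smem (spair n' y') g →
        (sset y' ∧ ∀ a, smem a y' ↔ (inBF a ∧ ∀ b, inBF b → erel b a → smem b y)))

end BF

end NFUweak
namespace NFUweak

/-! ## The Simple Theory of Types with Infinity (TSTI) -/

/-- Formulae of the many-sorted language `L_TST`, with named variables:
`mem n i j` is `x^n_i ∈_n x^{n+1}_j`, `eq n i j` is `x^n_i = x^n_j`, and
`all n i φ` is `∀ x^n_i, φ`. -/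
inductive TSTFormula : Type
  | mem (n i j : ℕ)
  | eq (n i j : ℕ)
  | fal
  | imp (φ ψ : TSTFormula)
  | all (n i : ℕ) (φ : TSTFormula)

/-- Update a many-sorted valuation at variable `x^n_i`. -/
def tstUpd {M : ℕ → Type} (v : ∀ n, ℕ → M n) (n i : ℕ) (a : M n) : ∀ m, ℕ → M m :=
  fun m j => if h : m = n ∧ j = i then (congrArg M h.1).symm ▸ a else v m j

/-- Satisfaction of an `L_TST`-formula in the many-sorted structure `⟨M, E⟩`
under the valuation `v`. -/
def TSTFormula.Realize {M : ℕ → Type} (E : ∀ n, M n → M (n + 1) → Prop) :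
    TSTFormula → (∀ n, ℕ → M n) → Prop
  | .mem n i j, v => E n (v n i) (v (n + 1) j)
  | .eq n i j, v => v n i = v n j
  | .fal, _ => False
  | .imp φ ψ, v => φ.Realize E v → ψ.Realize E v
  | .all n i φ, v => ∀ a : M n, φ.Realize E (tstUpd v n i a)

/-- All sorts mentioned in the formula are `< k` (so it is an `L_k`-formula). -/
def TSTFormula.sortsLT : TSTFormula → ℕ → Prop
  | .mem n _ _, k => n + 1 < k
  | .eq n _ _, k => n < k
  | .fal, _ => True
  | .imp φ ψ, k => φ.sortsLT k ∧ ψ.sortsLT k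
  | .all n _ φ, k => n < k ∧ φ.sortsLT k

/-- `p : M 2` is the Kuratowski ordered pair `⟨a, b⟩ = {{a},{a,b}}`. -/
def isKPair {M : ℕ → Type} (E : ∀ n, M n → M (n + 1) → Prop)
    (p : M 2) (a b : M 0) : Prop :=
  ∀ s : M 1, E 1 s p ↔
    ((∀ z, E 0 z s ↔ z = a) ∨ (∀ z, E 0 z s ↔ (z = a ∨ z = b)))

/-- The axiom of Infinity: there are `x¹` and `f³` such that `f³` codes an
injective, non-surjective function from `x¹` to `x¹` (with Kuratowski pairs). -/
def TSTInfinity {M : ℕ → Type} (E : ∀ n, M n → M (n + 1) → Prop) : Prop :=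
  ∃ (X : M 1) (f : M 3),
    (∀ p : M 2, E 2 p f → ∃ a b, E 0 a X ∧ E 0 b X ∧ isKPair E p a b) ∧
    (∀ a, E 0 a X → ∃ b p, E 0 b X ∧ E 2 p f ∧ isKPair E p a b) ∧
    (∀ a b b' p p', E 2 p f → E 2 p' f → isKPair E p a b → isKPair E p' a b' → b = b') ∧
    (∀ a a' b p p', E 2 p f → E 2 p' f → isKPair E p a b → isKPair E p' a' b → a = a') ∧
    (∃ b, E 0 b X ∧ ∀ a p, E 2 p f → ¬ isKPair E p a b)

/-- `⟨M, E⟩` is a model of TSTI: all sorts are nonempty and Extensionality,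
Comprehension (for every `L_TST`-formula) and Infinity hold. -/
def IsTSTIModel (M : ℕ → Type) (E : ∀ n, M n → M (n + 1) → Prop) : Prop :=
  (∀ n, Nonempty (M n)) ∧
    (∀ n, ∀ x y : M (n + 1), (∀ z, E n z x ↔ E n z y) → x = y) ∧
    (∀ (φ : TSTFormula) (n i : ℕ) (v : ∀ m, ℕ → M m),
      ∃ y : M (n + 1), ∀ x : M n, E n x y ↔ φ.Realize E (tstUpd v n i x)) ∧
    TSTInfinity E

/-- `⟨M, E⟩` is a model of the fragment TSTI_k, which only refers to the sorts
`< k` (so `k ≥ 4` is needed for the axiom of Infinity to be expressible). -/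
def IsTSTIModelBelow (k : ℕ) (M : ℕ → Type) (E : ∀ n, M n → M (n + 1) → Prop) : Prop :=
  (∀ n, n < k → Nonempty (M n)) ∧
    (∀ n, n + 1 < k → ∀ x y : M (n + 1), (∀ z, E n z x ↔ E n z y) → x = y) ∧
    (∀ (φ : TSTFormula), φ.sortsLT k → ∀ (n i : ℕ), n + 1 < k →
      ∀ v : ∀ m, ℕ → M m,
        ∃ y : M (n + 1), ∀ x : M n, E n x y ↔ φ.Realize E (tstUpd v n i x)) ∧
    TSTInfinity E

/-! ## The language of arithmetic and the internal arithmetic of a model -/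

/-- Function symbols of `L_PA`: `0`, `1`, `+` and `·`. -/
inductive PAFunc : ℕ → Type
  | zero : PAFunc 0
  | one : PAFunc 0
  | add : PAFunc 2
  | mul : PAFunc 2

/-- The language `L_PA` of arithmetic. -/
def LPA : Language := ⟨PAFunc, fun _ => Empty⟩

/-- The type of internal natural numbers of a model of NFU⁻ᴬᶜ. -/
def NatSub (M : Type) [LNFU.Structure M] : Type := {n : M // isNat n}

/-- An `L_PA`-structure on the internal natural numbers of `M` is the internal
arithmetic if its operations are given by the internal graphs of `0`, `1`,
cardinal addition and cardinal multiplication. -/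
def InternalArithOn (M : Type) [LNFU.Structure M] (A : LPA.Structure (NatSub M)) : Prop :=
  isZeroCard (A.funMap PAFunc.zero ![]).val ∧
    isOneCard (A.funMap PAFunc.one ![]).val ∧
    (∀ a b : NatSub M, cardAdd a.val b.val (A.funMap PAFunc.add ![a, b]).val) ∧
    (∀ a b : NatSub M, cardMul a.val b.val (A.funMap PAFunc.mul ![a, b]).val)

/-- `φ^ℕ` holds in `M`: the sentence `φ` of `L_PA` is true in the internal
arithmetic `⟨ℕ, +, ·, 0, 1⟩` of `M`. -/
def internalPASat (M : Type) [LNFU.Structure M] (φ : LPA.Sentence) : Prop :=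
  ∀ A : LPA.Structure (NatSub M), InternalArithOn M A →
    @Sentence.Realize LPA (NatSub M) A φ

end NFUweak
namespace NFUweak

/-! ## Semantic stratified definability -/

/-- Environments for a list of levels. -/
def Env (M : Type) : List ℕ → Type
  | [] => Unit
  | _ :: σ => Env M σ × M

def Env.tl {M : Type} {k : ℕ} {σ : List ℕ} (e : Env M (k :: σ)) : Env M σ := Prod.fst e
def Env.hd {M : Type} {k : ℕ} {σ : List ℕ} (e : Env M (k :: σ)) : M := Prod.snd e
def Env.push {M : Type} {k : ℕ} {σ : List ℕ} (e : Env M σ) (x : M) : Env M (k :: σ) := (e, x)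

section Meta

variable {M : Type} [LNFU.Structure M]

/-- Terms (as functions of the environment) of a given level. -/
inductive STm : (σ : List ℕ) → ℕ → (Env M σ → M) → Prop
  | const (σ : List ℕ) (k : ℕ) (c : M) : STm σ k (fun _ => c)
  | here (σ : List ℕ) (k : ℕ) : STm (k :: σ) k (fun e => e.hd)
  | there {σ : List ℕ} {k : ℕ} (l : ℕ) {t : Env M σ → M} (h : STm σ k t) :
      STm (l :: σ) k (fun e => t e.tl)
  | pair {σ : List ℕ} {k : ℕ} {t s : Env M σ → M} (h : STm σ k t) (h' : STm σ k s) :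
      STm σ k (fun e => spair (t e) (s e))

/-- Stratified-definable predicates of the environment. -/
inductive SFm : (σ : List ℕ) → (Env M σ → Prop) → Prop
  | fls (σ : List ℕ) : SFm σ (fun _ => False)
  | eq {σ : List ℕ} {k : ℕ} {t s : Env M σ → M} (h : STm σ k t) (h' : STm σ k s) :
      SFm σ (fun e => t e = s e)
  | mem {σ : List ℕ} {k : ℕ} {t s : Env M σ → M} (h : STm σ k t) (h' : STm σ (k + 1) s) :
      SFm σ (fun e => smem (t e) (s e))
  | set {σ : List ℕ} {k : ℕ} {t : Env M σ → M} (h : STm σ k t) :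
      SFm σ (fun e => sset (t e))
  | imp {σ : List ℕ} {P Q : Env M σ → Prop} (h : SFm σ P) (h' : SFm σ Q) :
      SFm σ (fun e => P e → Q e)
  | all {σ : List ℕ} (k : ℕ) {P : Env M σ → M → Prop}
      (h : SFm (k :: σ) (fun e => P e.tl e.hd)) :
      SFm σ (fun e => ∀ x, P e x)

def evec {m : ℕ} (g : Fin m → M × ℕ) : (σ : List ℕ) → Env M σ → (Fin (m + σ.length) → M)
  | [], _ => fun i => (g i).1
  | _ :: σ, e => Fin.snoc (α := fun _ => M) (evec g σ e.tl) e.hd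

def elev {m : ℕ} (g : Fin m → M × ℕ) : (σ : List ℕ) → (Fin (m + σ.length) → ℕ)
  | [] => fun i => (g i).2
  | k :: σ => Fin.snoc (α := fun _ => ℕ) (elev g σ) k

def elevS {m : ℕ} (g : Fin m → M × ℕ) (σ : List ℕ) : Empty ⊕ Fin (m + σ.length) → ℕ :=
  Sum.elim (fun e => Empty.elim e) (elev g σ)

theorem termLevel_liftS {n : ℕ} (τ : LNFU.Term (Empty ⊕ Fin n)) (s : Empty ⊕ Fin n → ℕ)
    (s' : Empty ⊕ Fin (n + 1) → ℕ) (h : ∀ i : Fin n, s' (Sum.inr i.castSucc) = s (Sum.inr i))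
    (k : ℕ) (hk : termLevel s τ k) :
    termLevel s' (τ.relabel (Sum.map id Fin.castSucc)) k := by
  induction τ with
  | var v =>
    rcases v with v | v
    · exact v.elim
    · simp only [termLevel, Term.relabel, Sum.map_inr] at hk ⊢
      rw [h]; exact hk
  | func f ts ih =>
    simp only [termLevel, Term.relabel] at hk ⊢
    exact fun i => ih i (hk i)

theorem STm.code {σ : List ℕ} {k : ℕ} {t : Env M σ → M} (h : STm σ k t) :
    ∃ F : Finset (M × ℕ), ∀ (m : ℕ) (g : Fin m → M × ℕ), (F : Set (M × ℕ)) ⊆ Set.range g →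
      ∃ τ : LNFU.Term (Empty ⊕ Fin (m + σ.length)), termLevel (elevS g σ) τ k ∧
        ∀ e, τ.realize (Sum.elim default (evec g σ e)) = t e := by
  classical
  induction h with
  | const σ k c =>
    refine ⟨{(c, k)}, fun m g hg => ?_⟩
    obtain ⟨i, hi⟩ := hg (by simp : (c, k) ∈ _)
    induction σ with
    | nil =>
      refine ⟨Term.var (Sum.inr i), ?_, fun e => ?_⟩
      · simp [termLevel, elevS, elev, hi]
      · simp [evec, hi]
    | cons l σ ih =>
      obtain ⟨τ, h1, h2⟩ := ih
      refine ⟨τ.relabel (Sum.map id Fin.castSucc), ?_, fun e => ?_⟩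
      · exact termLevel_liftS τ _ _ (fun i => by simp [elevS, elev]) _ h1
      · rw [Term.realize_relabel]
        rw [← h2 e.tl]
        congr 1
        funext v
        rcases v with v | v
        · exact v.elim
        · simp [evec]
  | here σ k =>
    refine ⟨∅, fun m g _ => ⟨Term.var (Sum.inr (Fin.last (m + σ.length))), ?_, fun e => ?_⟩⟩
    · simp [termLevel, elevS, elev]
    · simp [evec]
  | @there σ k l t h ih =>
    obtain ⟨F, hF⟩ := ih
    refine ⟨F, fun m g hg => ?_⟩
    obtain ⟨τ, h1, h2⟩ := hF m g hg
    refine ⟨τ.relabel (Sum.map id Fin.castSucc), ?_, fun e => ?_⟩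
    · exact termLevel_liftS τ _ _ (fun i => by simp [elevS, elev]) _ h1
    · rw [Term.realize_relabel]
      show _ = t e.tl
      rw [← h2 e.tl]
      congr 1
      funext v
      rcases v with v | v
      · exact v.elim
      · simp [evec]
  | pair h h' ih ih' =>
    obtain ⟨F, hF⟩ := ih
    obtain ⟨G, hG⟩ := ih'
    refine ⟨F ∪ G, fun m g hg => ?_⟩
    rw [Finset.coe_union, Set.union_subset_iff] at hg
    obtain ⟨τ, h1, h2⟩ := hF m g hg.1
    obtain ⟨τ', h1', h2'⟩ := hG m g hg.2
    refine ⟨Functions.apply₂ pairF τ τ', ?_, fun e => ?_⟩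
    · intro i
      match i with
      | 0 => exact h1
      | 1 => exact h1'
    · rw [Term.realize_functions_apply₂, h2, h2']; rfl

theorem SFm.code {σ : List ℕ} {P : Env M σ → Prop} (h : SFm σ P) :
    ∃ F : Finset (M × ℕ), ∀ (m : ℕ) (g : Fin m → M × ℕ), (F : Set (M × ℕ)) ⊆ Set.range g →
      ∃ φ : LNFU.BoundedFormula Empty (m + σ.length), stratifiedFrom (elevS g σ) φ ∧
        ∀ e, φ.Realize default (evec g σ e) ↔ P e := by
  classical
  induction h with
  | fls σ =>
    exact ⟨∅, fun m g _ => ⟨BoundedFormula.falsum, trivial, fun e => Iff.rfl⟩⟩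
  | eq h h' =>
    obtain ⟨F, hF⟩ := h.code
    obtain ⟨G, hG⟩ := h'.code
    refine ⟨F ∪ G, fun m g hg => ?_⟩
    rw [Finset.coe_union, Set.union_subset_iff] at hg
    obtain ⟨τ, h1, h2⟩ := hF m g hg.1
    obtain ⟨τ', h1', h2'⟩ := hG m g hg.2
    refine ⟨BoundedFormula.equal τ τ', ⟨_, h1, h1'⟩, fun e => ?_⟩
    beta_reduce
    rw [← h2 e, ← h2' e]; rfl
  | mem h h' =>
    obtain ⟨F, hF⟩ := h.code
    obtain ⟨G, hG⟩ := h'.code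
    refine ⟨F ∪ G, fun m g hg => ?_⟩
    rw [Finset.coe_union, Set.union_subset_iff] at hg
    obtain ⟨τ, h1, h2⟩ := hF m g hg.1
    obtain ⟨τ', h1', h2'⟩ := hG m g hg.2
    refine ⟨memR.boundedFormula₂ τ τ', ⟨_, h1, h1'⟩, fun e => ?_⟩
    rw [BoundedFormula.realize_rel₂, h2 e, h2' e]; rfl
  | set h =>
    obtain ⟨F, hF⟩ := h.code
    refine ⟨F, fun m g hg => ?_⟩
    obtain ⟨τ, h1, h2⟩ := hF m g hg
    refine ⟨setR.boundedFormula₁ τ, ⟨_, h1⟩, fun e => ?_⟩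
    rw [BoundedFormula.realize_rel₁, h2 e]; rfl
  | imp h h' ih ih' =>
    obtain ⟨F, hF⟩ := ih
    obtain ⟨G, hG⟩ := ih'
    refine ⟨F ∪ G, fun m g hg => ?_⟩
    rw [Finset.coe_union, Set.union_subset_iff] at hg
    obtain ⟨τ, h1, h2⟩ := hF m g hg.1
    obtain ⟨τ', h1', h2'⟩ := hG m g hg.2
    refine ⟨τ.imp τ', ⟨h1, h1'⟩, fun e => ?_⟩
    rw [BoundedFormula.realize_imp, h2 e, h2' e]
  | @all σ k P h ih =>
    obtain ⟨F, hF⟩ := ih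
    refine ⟨F, fun m g hg => ?_⟩
    obtain ⟨φ, h1, h2⟩ := hF m g hg
    refine ⟨BoundedFormula.all φ, ⟨k, ?_⟩, fun e => ?_⟩
    · have hl : (Sum.elim (fun e => elevS g σ (Sum.inl e))
          (Fin.snoc (fun i => elevS g σ (Sum.inr i)) k) : Empty ⊕ Fin (m + σ.length + 1) → ℕ) =
          elevS g (k :: σ) := by
        funext v
        rcases v with v | v
        · exact v.elim
        · rfl
      rw [hl]
      exact h1
    · refine forall_congr' fun x => ?_
      exact h2 (Env.push e x)

/-- Models of NFU⁻ᴬᶜ. -/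
class NFUModel (M : Type) [LNFU.Structure M] : Prop where
  models : M ⊨ NFUmAC

variable [NFUModel M]

theorem ax_of_mem {s : LNFU.Sentence} (h : s ∈ NFUmAC) : M ⊨ s :=
  (NFUModel.models (M := M)).realize_of_mem s h

theorem comp_of {k : ℕ} {P : M → Prop} (h : SFm [k] (fun e => P e.hd)) :
    ∃ y : M, sset y ∧ ∀ x, smem x y ↔ P x := by
  classical
  obtain ⟨F, hF⟩ := h.code
  obtain ⟨φ, h1, h2⟩ := hF F.toList.length F.toList.get (by
    intro p hp
    have : p ∈ F.toList := by simpa using hp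
    obtain ⟨i, hi⟩ := List.get_of_mem this
    exact ⟨i, hi⟩)
  generalize F.toList.get = g at *
  generalize F.toList.length = m at *
  have hax : M ⊨ comprehensionAx m φ :=
    ax_of_mem (Or.inr ⟨m, φ, ⟨_, h1⟩, rfl⟩)
  rw [comprehensionAx] at hax
  have hax2 := BoundedFormula.realize_alls.1 hax
  obtain ⟨y, hy⟩ := BoundedFormula.realize_ex.1 (hax2 (fun i => (g i).1))
  rw [BoundedFormula.realize_inf] at hy
  obtain ⟨hy1, hy2⟩ := hy
  refine ⟨y, ?_, fun x => ?_⟩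
  · rw [BoundedFormula.realize_rel₁] at hy1
    unfold sset
    convert hy1 using 1
    funext i
    simp [Fin.snoc]
  · have := hy2 x
    rw [BoundedFormula.realize_iff, BoundedFormula.realize_rel₂,
      BoundedFormula.realize_liftAt_one (by omega)] at this
    refine Iff.trans ?_ (h2 (Env.push (k := k) (σ := []) () x))
    unfold smem
    convert this using 2
    · funext i
      match i with
      | 0 => simp [Fin.snoc]
      | 1 => simp [Fin.snoc]
    · rfl
    · funext i
      refine Fin.lastCases ?_ (fun j => ?_) i
      · simp [evec, Fin.snoc, Env.push, Env.hd]
      · simp [evec, Fin.snoc, Env.push, Env.hd, Env.tl]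

theorem sext {x y : M} (hx : sset x) (hy : sset y) (h : ∀ z, smem z x ↔ smem z y) : x = y := by
  have hax : M ⊨ weakExtAx := ax_of_mem (Or.inl (Or.inl rfl))
  have := hax x y
  simp only [BoundedFormula.realize_imp, BoundedFormula.realize_inf, BoundedFormula.realize_rel₁,
    BoundedFormula.realize_iff, BoundedFormula.realize_bdEqual, BoundedFormula.realize_all,
    BoundedFormula.realize_rel₂] at this
  refine (this ⟨?_, ?_⟩).2 (fun z => ?_)
  · exact hx
  · exact hy
  · exact h z

theorem spair_inj {x y w z : M} (h : spair x y = spair w z) : x = w ∧ y = z := by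
  have hax : M ⊨ pairingAx := ax_of_mem (Or.inl (Or.inr rfl))
  have := hax x y w z
  simp only [BoundedFormula.realize_imp, BoundedFormula.realize_inf,
    BoundedFormula.realize_bdEqual, Term.realize_functions_apply₂] at this
  exact this h

end Meta

section Auto

variable {M : Type} [LNFU.Structure M]

theorem SFm.congr {σ : List ℕ} {P Q : Env M σ → Prop} (h : SFm σ P) (hPQ : ∀ e, P e ↔ Q e) :
    SFm σ Q := by
  have : P = Q := funext fun e => propext (hPQ e)
  exact this ▸ h

theorem SFm.not {σ : List ℕ} {P : Env M σ → Prop} (h : SFm σ P) : SFm σ (fun e => ¬ P e) :=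
  SFm.imp h (SFm.fls σ)

theorem SFm.and {σ : List ℕ} {P Q : Env M σ → Prop} (h : SFm σ P) (h' : SFm σ Q) :
    SFm σ (fun e => P e ∧ Q e) :=
  (SFm.not (SFm.imp h h'.not)).congr (fun e => by tauto)

theorem SFm.or {σ : List ℕ} {P Q : Env M σ → Prop} (h : SFm σ P) (h' : SFm σ Q) :
    SFm σ (fun e => P e ∨ Q e) :=
  (SFm.imp h.not h').congr (fun e => by tauto)

theorem SFm.iff {σ : List ℕ} {P Q : Env M σ → Prop} (h : SFm σ P) (h' : SFm σ Q) :
    SFm σ (fun e => P e ↔ Q e) :=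
  (SFm.and (SFm.imp h h') (SFm.imp h' h)).congr (fun e => by tauto)

theorem SFm.ex {σ : List ℕ} (k : ℕ) {P : Env M σ → M → Prop}
    (h : SFm (k :: σ) (fun e => P e.tl e.hd)) :
    SFm σ (fun e => ∃ x, P e x) :=
  (SFm.not (SFm.all k (P := fun e x => ¬ P e x) h.not)).congr (fun e => by simp)

theorem SFm.ne {σ : List ℕ} {k : ℕ} {t s : Env M σ → M} (h : STm σ k t) (h' : STm σ k s) :
    SFm σ (fun e => t e ≠ s e) :=
  SFm.not (SFm.eq h h')

theorem STm.v0 {σ : List ℕ} {k0 : ℕ} :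
    STm (M := M) (k0 :: σ) k0 (fun e => e.hd) :=
  STm.here _ _

theorem STm.v1 {σ : List ℕ} {k0 k1 : ℕ} :
    STm (M := M) (k0 :: k1 :: σ) k1 (fun e => e.tl.hd) :=
  STm.there _ (STm.v0)

theorem STm.v2 {σ : List ℕ} {k0 k1 k2 : ℕ} :
    STm (M := M) (k0 :: k1 :: k2 :: σ) k2 (fun e => e.tl.tl.hd) :=
  STm.there _ (STm.v1)

theorem STm.v3 {σ : List ℕ} {k0 k1 k2 k3 : ℕ} :
    STm (M := M) (k0 :: k1 :: k2 :: k3 :: σ) k3 (fun e => e.tl.tl.tl.hd) :=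
  STm.there _ (STm.v2)

theorem STm.v4 {σ : List ℕ} {k0 k1 k2 k3 k4 : ℕ} :
    STm (M := M) (k0 :: k1 :: k2 :: k3 :: k4 :: σ) k4 (fun e => e.tl.tl.tl.tl.hd) :=
  STm.there _ (STm.v3)

theorem STm.v5 {σ : List ℕ} {k0 k1 k2 k3 k4 k5 : ℕ} :
    STm (M := M) (k0 :: k1 :: k2 :: k3 :: k4 :: k5 :: σ) k5 (fun e => e.tl.tl.tl.tl.tl.hd) :=
  STm.there _ (STm.v4)

theorem STm.v6 {σ : List ℕ} {k0 k1 k2 k3 k4 k5 k6 : ℕ} :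
    STm (M := M) (k0 :: k1 :: k2 :: k3 :: k4 :: k5 :: k6 :: σ) k6 (fun e => e.tl.tl.tl.tl.tl.tl.hd) :=
  STm.there _ (STm.v5)

theorem STm.v7 {σ : List ℕ} {k0 k1 k2 k3 k4 k5 k6 k7 : ℕ} :
    STm (M := M) (k0 :: k1 :: k2 :: k3 :: k4 :: k5 :: k6 :: k7 :: σ) k7 (fun e => e.tl.tl.tl.tl.tl.tl.tl.hd) :=
  STm.there _ (STm.v6)

theorem STm.v8 {σ : List ℕ} {k0 k1 k2 k3 k4 k5 k6 k7 k8 : ℕ} :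
    STm (M := M) (k0 :: k1 :: k2 :: k3 :: k4 :: k5 :: k6 :: k7 :: k8 :: σ) k8 (fun e => e.tl.tl.tl.tl.tl.tl.tl.tl.hd) :=
  STm.there _ (STm.v7)

theorem STm.v9 {σ : List ℕ} {k0 k1 k2 k3 k4 k5 k6 k7 k8 k9 : ℕ} :
    STm (M := M) (k0 :: k1 :: k2 :: k3 :: k4 :: k5 :: k6 :: k7 :: k8 :: k9 :: σ) k9 (fun e => e.tl.tl.tl.tl.tl.tl.tl.tl.tl.hd) :=
  STm.there _ (STm.v8)

theorem STm.v10 {σ : List ℕ} {k0 k1 k2 k3 k4 k5 k6 k7 k8 k9 k10 : ℕ} :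
    STm (M := M) (k0 :: k1 :: k2 :: k3 :: k4 :: k5 :: k6 :: k7 :: k8 :: k9 :: k10 :: σ) k10 (fun e => e.tl.tl.tl.tl.tl.tl.tl.tl.tl.tl.hd) :=
  STm.there _ (STm.v9)

theorem STm.v11 {σ : List ℕ} {k0 k1 k2 k3 k4 k5 k6 k7 k8 k9 k10 k11 : ℕ} :
    STm (M := M) (k0 :: k1 :: k2 :: k3 :: k4 :: k5 :: k6 :: k7 :: k8 :: k9 :: k10 :: k11 :: σ) k11 (fun e => e.tl.tl.tl.tl.tl.tl.tl.tl.tl.tl.tl.hd) :=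
  STm.there _ (STm.v10)

theorem STm.v12 {σ : List ℕ} {k0 k1 k2 k3 k4 k5 k6 k7 k8 k9 k10 k11 k12 : ℕ} :
    STm (M := M) (k0 :: k1 :: k2 :: k3 :: k4 :: k5 :: k6 :: k7 :: k8 :: k9 :: k10 :: k11 :: k12 :: σ) k12 (fun e => e.tl.tl.tl.tl.tl.tl.tl.tl.tl.tl.tl.tl.hd) :=
  STm.there _ (STm.v11)

theorem STm.v13 {σ : List ℕ} {k0 k1 k2 k3 k4 k5 k6 k7 k8 k9 k10 k11 k12 k13 : ℕ} :
    STm (M := M) (k0 :: k1 :: k2 :: k3 :: k4 :: k5 :: k6 :: k7 :: k8 :: k9 :: k10 :: k11 :: k12 :: k13 :: σ) k13 (fun e => e.tl.tl.tl.tl.tl.tl.tl.tl.tl.tl.tl.tl.tl.hd) :=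
  STm.there _ (STm.v12)

theorem STm.v14 {σ : List ℕ} {k0 k1 k2 k3 k4 k5 k6 k7 k8 k9 k10 k11 k12 k13 k14 : ℕ} :
    STm (M := M) (k0 :: k1 :: k2 :: k3 :: k4 :: k5 :: k6 :: k7 :: k8 :: k9 :: k10 :: k11 :: k12 :: k13 :: k14 :: σ) k14 (fun e => e.tl.tl.tl.tl.tl.tl.tl.tl.tl.tl.tl.tl.tl.tl.hd) :=
  STm.there _ (STm.v13)

theorem STm.v15 {σ : List ℕ} {k0 k1 k2 k3 k4 k5 k6 k7 k8 k9 k10 k11 k12 k13 k14 k15 : ℕ} :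
    STm (M := M) (k0 :: k1 :: k2 :: k3 :: k4 :: k5 :: k6 :: k7 :: k8 :: k9 :: k10 :: k11 :: k12 :: k13 :: k14 :: k15 :: σ) k15 (fun e => e.tl.tl.tl.tl.tl.tl.tl.tl.tl.tl.tl.tl.tl.tl.tl.hd) :=
  STm.there _ (STm.v14)

theorem STm.v16 {σ : List ℕ} {k0 k1 k2 k3 k4 k5 k6 k7 k8 k9 k10 k11 k12 k13 k14 k15 k16 : ℕ} :
    STm (M := M) (k0 :: k1 :: k2 :: k3 :: k4 :: k5 :: k6 :: k7 :: k8 :: k9 :: k10 :: k11 :: k12 :: k13 :: k14 :: k15 :: k16 :: σ) k16 (fun e => e.tl.tl.tl.tl.tl.tl.tl.tl.tl.tl.tl.tl.tl.tl.tl.tl.hd) :=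
  STm.there _ (STm.v15)

theorem STm.v17 {σ : List ℕ} {k0 k1 k2 k3 k4 k5 k6 k7 k8 k9 k10 k11 k12 k13 k14 k15 k16 k17 : ℕ} :
    STm (M := M) (k0 :: k1 :: k2 :: k3 :: k4 :: k5 :: k6 :: k7 :: k8 :: k9 :: k10 :: k11 :: k12 :: k13 :: k14 :: k15 :: k16 :: k17 :: σ) k17 (fun e => e.tl.tl.tl.tl.tl.tl.tl.tl.tl.tl.tl.tl.tl.tl.tl.tl.tl.hd) :=
  STm.there _ (STm.v16)

theorem STm.v18 {σ : List ℕ} {k0 k1 k2 k3 k4 k5 k6 k7 k8 k9 k10 k11 k12 k13 k14 k15 k16 k17 k18 : ℕ} :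
    STm (M := M) (k0 :: k1 :: k2 :: k3 :: k4 :: k5 :: k6 :: k7 :: k8 :: k9 :: k10 :: k11 :: k12 :: k13 :: k14 :: k15 :: k16 :: k17 :: k18 :: σ) k18 (fun e => e.tl.tl.tl.tl.tl.tl.tl.tl.tl.tl.tl.tl.tl.tl.tl.tl.tl.tl.hd) :=
  STm.there _ (STm.v17)

theorem STm.v19 {σ : List ℕ} {k0 k1 k2 k3 k4 k5 k6 k7 k8 k9 k10 k11 k12 k13 k14 k15 k16 k17 k18 k19 : ℕ} :
    STm (M := M) (k0 :: k1 :: k2 :: k3 :: k4 :: k5 :: k6 :: k7 :: k8 :: k9 :: k10 :: k11 :: k12 :: k13 :: k14 :: k15 :: k16 :: k17 :: k18 :: k19 :: σ) k19 (fun e => e.tl.tl.tl.tl.tl.tl.tl.tl.tl.tl.tl.tl.tl.tl.tl.tl.tl.tl.tl.hd) :=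
  STm.there _ (STm.v18)

theorem strat_auto {σ : List ℕ} {P : Env M σ → Prop} (h : SFm σ P := by
  (repeat' first
    | apply STm.v0
    | apply STm.v1
    | apply STm.v2
    | apply STm.v3
    | apply STm.v4
    | apply STm.v5
    | apply STm.v6
    | apply STm.v7
    | apply STm.v8
    | apply STm.v9
    | apply STm.v10
    | apply STm.v11
    | apply STm.v12
    | apply STm.v13
    | apply STm.v14
    | apply STm.v15
    | apply STm.v16
    | apply STm.v17
    | apply STm.v18
    | apply STm.v19
    | apply STm.const
    | apply STm.pair
    | apply SFm.mem
    | apply SFm.eq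
    | apply SFm.ne
    | apply SFm.set
    | apply SFm.fls
    | apply SFm.not
    | apply SFm.and
    | apply SFm.or
    | apply SFm.iff
    | apply SFm.imp
    | apply SFm.all
    | apply SFm.ex)
  all_goals exact 0) : SFm σ P := h

end Auto

section Basics

variable {M : Type} [LNFU.Structure M] [NFUModel M]

theorem equip_mk (R : M → M → Prop)
    (hR : ∀ σ : List ℕ, SFm (M := M) (10 :: 10 :: σ) (fun e => R e.tl.hd e.hd)) {X Y : M}
    (h1 : ∀ a, smem a X → ∃ b, smem b Y ∧ R a b)
    (h2 : ∀ a b b', smem a X → smem b Y → smem b' Y → R a b → R a b' → b = b')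
    (h3 : ∀ a a' b, smem a X → smem a' X → smem b Y → R a b → R a' b → a = a')
    (h4 : ∀ b, smem b Y → ∃ a, smem a X ∧ R a b) : equipollent X Y := by
  obtain ⟨f, hf, hf'⟩ := comp_of (M := M) (k := 10)
    (P := fun p => ∃ a b, p = spair a b ∧ (smem a X ∧ smem b Y) ∧ R a b)
    (SFm.ex 10 (SFm.ex 10 (SFm.and strat_auto (SFm.and strat_auto (hR _)))))
  have key : ∀ a b, smem (spair a b) f ↔ (smem a X ∧ smem b Y) ∧ R a b := by
    intro a b
    rw [hf']
    constructor
    · rintro ⟨a', b', h, h'⟩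
      obtain ⟨rfl, rfl⟩ := spair_inj h
      exact h'
    · intro h
      exact ⟨a, b, rfl, h⟩
  refine ⟨f, ⟨⟨hf, ?_, ?_, ?_⟩, ?_⟩, ?_⟩
  · intro p hp
    obtain ⟨a, b, h, h', _⟩ := (hf' p).1 hp
    exact ⟨a, b, h, h'⟩
  · intro a ha
    obtain ⟨b, hb, hr⟩ := h1 a ha
    exact ⟨b, (key a b).2 ⟨⟨ha, hb⟩, hr⟩⟩
  · intro a b b' h h'
    rw [key] at h h'
    exact h2 a b b' h.1.1 h.1.2 h'.1.2 h.2 h'.2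
  · intro a b b' h h'
    rw [key] at h h'
    exact h3 a b b' h.1.1 h'.1.1 h.1.2 h.2 h'.2
  · intro b hb
    obtain ⟨a, ha, hr⟩ := h4 b hb
    exact ⟨a, (key a b).2 ⟨⟨ha, hb⟩, hr⟩⟩

/-- An external description of internal bijections. -/
structure BijRel (f X Y : M) : Prop where
  left : ∀ a b, smem (spair a b) f → smem a X
  right : ∀ a b, smem (spair a b) f → smem b Y
  tot : ∀ a, smem a X → ∃ b, smem (spair a b) f
  fn : ∀ a b b', smem (spair a b) f → smem (spair a b') f → b = b'
  inj : ∀ a a' b, smem (spair a b) f → smem (spair a' b) f → a = a'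
  surj : ∀ b, smem b Y → ∃ a, smem (spair a b) f

theorem equip_elim {X Y : M} (h : equipollent X Y) : ∃ f, BijRel f X Y := by
  obtain ⟨f, ⟨⟨_, h1, h2, h3⟩, h4⟩, h5⟩ := h
  have key : ∀ a b, smem (spair a b) f → smem a X ∧ smem b Y := by
    intro a b h
    obtain ⟨a', b', h, h'⟩ := h1 _ h
    obtain ⟨rfl, rfl⟩ := spair_inj h
    exact h'
  exact ⟨f, fun a b h => (key a b h).1, fun a b h => (key a b h).2, h2, h3, h4, h5⟩

theorem equip_of_ext {X Y : M} (h : ∀ z, smem z X ↔ smem z Y) : equipollent X Y := by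
  refine equip_mk (fun a b => a = b) (fun σ => strat_auto) ?_ ?_ ?_ ?_
  · intro a ha; exact ⟨a, (h a).1 ha, rfl⟩
  · rintro a b b' - - - rfl h; exact h
  · rintro a b b' - - - rfl h; exact h.symm
  · intro a ha; exact ⟨a, (h a).2 ha, rfl⟩

theorem equip_refl (X : M) : equipollent X X := equip_of_ext (fun _ => Iff.rfl)

theorem equip_symm {X Y : M} (h : equipollent X Y) : equipollent Y X := by
  obtain ⟨f, hf⟩ := equip_elim h
  refine equip_mk (fun a b => smem (spair b a) f) (fun σ => strat_auto) ?_ ?_ ?_ ?_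
  · intro a ha
    obtain ⟨b, hb⟩ := hf.surj a ha
    exact ⟨b, hf.left _ _ hb, hb⟩
  · intro a b b' _ _ _ h h'; exact hf.inj _ _ _ h h'
  · intro a b b' _ _ _ h h'; exact hf.fn _ _ _ h h'
  · intro a ha
    obtain ⟨b, hb⟩ := hf.tot a ha
    exact ⟨b, hf.right _ _ hb, hb⟩

theorem equip_trans {X Y Z : M} (h : equipollent X Y) (h' : equipollent Y Z) :
    equipollent X Z := by
  obtain ⟨f, hf⟩ := equip_elim h
  obtain ⟨g, hg⟩ := equip_elim h'
  refine equip_mk (fun a b => ∃ c, smem (spair a c) f ∧ smem (spair c b) g)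
    (fun σ => strat_auto) ?_ ?_ ?_ ?_
  · intro a ha
    obtain ⟨c, hc⟩ := hf.tot a ha
    obtain ⟨b, hb⟩ := hg.tot c (hf.right _ _ hc)
    exact ⟨b, hg.right _ _ hb, c, hc, hb⟩
  · rintro a b b' _ _ _ ⟨c, h1, h2⟩ ⟨c', h1', h2'⟩
    obtain rfl := hf.fn _ _ _ h1 h1'
    exact hg.fn _ _ _ h2 h2'
  · rintro a b b' _ _ _ ⟨c, h1, h2⟩ ⟨c', h1', h2'⟩
    obtain rfl := hg.inj _ _ _ h2 h2'
    exact hf.inj _ _ _ h1 h1'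
  · intro b hb
    obtain ⟨c, hc⟩ := hg.surj b hb
    obtain ⟨a, ha⟩ := hf.surj c (hg.left _ _ hc)
    exact ⟨a, hf.left _ _ ha, c, ha, hc⟩

theorem equip_union {x y x' y' u u' : M} (h : equipollent x x') (h' : equipollent y y')
    (hd : ∀ w, ¬ (smem w x ∧ smem w y)) (hd' : ∀ w, ¬ (smem w x' ∧ smem w y'))
    (hu : ∀ w, smem w u ↔ (smem w x ∨ smem w y))
    (hu' : ∀ w, smem w u' ↔ (smem w x' ∨ smem w y')) : equipollent u u' := by
  obtain ⟨f, hf⟩ := equip_elim h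
  obtain ⟨g, hg⟩ := equip_elim h'
  refine equip_mk (fun a b => smem (spair a b) f ∨ smem (spair a b) g)
    (fun σ => strat_auto) ?_ ?_ ?_ ?_
  · intro a ha
    rcases (hu a).1 ha with ha | ha
    · obtain ⟨b, hb⟩ := hf.tot a ha
      exact ⟨b, (hu' b).2 (Or.inl (hf.right _ _ hb)), Or.inl hb⟩
    · obtain ⟨b, hb⟩ := hg.tot a ha
      exact ⟨b, (hu' b).2 (Or.inr (hg.right _ _ hb)), Or.inr hb⟩
  · rintro a b b' _ _ _ (h1 | h1) (h2 | h2)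
    · exact hf.fn _ _ _ h1 h2
    · exact (hd a ⟨hf.left _ _ h1, hg.left _ _ h2⟩).elim
    · exact (hd a ⟨hf.left _ _ h2, hg.left _ _ h1⟩).elim
    · exact hg.fn _ _ _ h1 h2
  · rintro a b b' _ _ _ (h1 | h1) (h2 | h2)
    · exact hf.inj _ _ _ h1 h2
    · exact (hd' b' ⟨hf.right _ _ h1, hg.right _ _ h2⟩).elim
    · exact (hd' b' ⟨hf.right _ _ h2, hg.right _ _ h1⟩).elim
    · exact hg.inj _ _ _ h1 h2
  · intro b hb
    rcases (hu' b).1 hb with hb | hb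
    · obtain ⟨a, ha⟩ := hf.surj b hb
      exact ⟨a, (hu a).2 (Or.inl (hf.left _ _ ha)), Or.inl ha⟩
    · obtain ⟨a, ha⟩ := hg.surj b hb
      exact ⟨a, (hu a).2 (Or.inr (hg.left _ _ ha)), Or.inr ha⟩

theorem equip_prod {x y x' y' P P' : M} (h : equipollent x x') (h' : equipollent y y')
    (hP : isProdOf P x y) (hP' : isProdOf P' x' y') : equipollent P P' := by
  obtain ⟨f, hf⟩ := equip_elim h
  obtain ⟨g, hg⟩ := equip_elim h'
  refine equip_mk (fun p q => ∃ a b c d, p = spair a b ∧ q = spair c d ∧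
    smem (spair a c) f ∧ smem (spair b d) g) (fun σ => strat_auto) ?_ ?_ ?_ ?_
  · intro p hp
    obtain ⟨a, b, ha, hb, rfl⟩ := (hP.2 p).1 hp
    obtain ⟨c, hc⟩ := hf.tot a ha
    obtain ⟨d, hd⟩ := hg.tot b hb
    exact ⟨spair c d, (hP'.2 _).2 ⟨c, d, hf.right _ _ hc, hg.right _ _ hd, rfl⟩,
      a, b, c, d, rfl, rfl, hc, hd⟩
  · rintro p q q' _ _ _ ⟨a, b, c, d, rfl, rfl, h1, h2⟩ ⟨a', b', c', d', e, rfl, h1', h2'⟩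
    obtain ⟨rfl, rfl⟩ := spair_inj e
    rw [hf.fn _ _ _ h1 h1', hg.fn _ _ _ h2 h2']
  · rintro p q q' _ _ _ ⟨a, b, c, d, rfl, rfl, h1, h2⟩ ⟨a', b', c', d', rfl, e, h1', h2'⟩
    obtain ⟨rfl, rfl⟩ := spair_inj e
    rw [hf.inj _ _ _ h1 h1', hg.inj _ _ _ h2 h2']
  · intro q hq
    obtain ⟨c, d, hc, hd, rfl⟩ := (hP'.2 q).1 hq
    obtain ⟨a, ha⟩ := hf.surj c hc
    obtain ⟨b, hb⟩ := hg.surj d hd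
    exact ⟨spair a b, (hP.2 _).2 ⟨a, b, hf.left _ _ ha, hg.left _ _ hb, rfl⟩,
      a, b, c, d, rfl, rfl, ha, hb⟩

/-! ### Existence of sets -/

theorem ex_diff (y z : M) : ∃ d : M, sset d ∧ ∀ w, smem w d ↔ (smem w y ∧ w ≠ z) :=
  comp_of (k := 10) strat_auto

theorem ex_union (x y : M) : ∃ d : M, sset d ∧ ∀ w, smem w d ↔ (smem w x ∨ smem w y) :=
  comp_of (k := 10) strat_auto

theorem ex_sing (x : M) : ∃ s : M, isSingletonOf s x :=
  comp_of (k := 10) strat_auto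

theorem ex_iota (X : M) : ∃ Y : M, isIotaImageOf Y X :=
  comp_of (k := 10) strat_auto

theorem ex_card (X : M) : ∃ Y : M, isCardOf Y X :=
  comp_of (k := 10) strat_auto

theorem ex_prod (x y : M) : ∃ P : M, isProdOf P x y :=
  comp_of (k := 10) strat_auto

theorem ex_empty : ∃ e : M, isEmptySet e := by
  obtain ⟨e, h, h'⟩ := comp_of (M := M) (k := 10) (P := fun _ => False) strat_auto
  exact ⟨e, h, fun z hz => (h' z).1 hz⟩

theorem ex_zero : ∃ z : M, isZeroCard z :=
  comp_of (k := 10) strat_auto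

theorem ex_succ (a : M) : ∃ s : M, isSuccOf s a :=
  comp_of (k := 10) strat_auto

theorem sing_inj {s x y : M} (h : isSingletonOf s x) (h' : isSingletonOf s y) : x = y :=
  (h'.2 x).1 ((h.2 x).2 rfl)

theorem sing_uniq {s t x : M} (h : isSingletonOf s x) (h' : isSingletonOf t x) : s = t :=
  sext h.1 h'.1 (fun z => by rw [h.2, h'.2])

theorem zero_uniq {s t : M} (h : isZeroCard s) (h' : isZeroCard t) : s = t :=
  sext h.1 h'.1 (fun z => by rw [h.2, h'.2])

theorem succ_uniq {s t x : M} (h : isSuccOf s x) (h' : isSuccOf t x) : s = t :=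
  sext h.1 h'.1 (fun z => by rw [h.2, h'.2])

theorem card_uniq {s t x : M} (h : isCardOf s x) (h' : isCardOf t x) : s = t :=
  sext h.1 h'.1 (fun z => by rw [h.2, h'.2])

theorem nat_zero {z : M} (h : isZeroCard z) : isNat z := fun I hI => hI.2.1 z h

theorem nat_succ {a s : M} (ha : isNat a) (h : isSuccOf s a) : isNat s :=
  fun I hI => hI.2.2 a s (ha I hI) h

theorem nat_ind (P : M → Prop) (hP : SFm [10] (fun e => P e.hd))
    (h0 : ∀ z, isZeroCard z → P z)
    (hS : ∀ a b, isNat a → P a → isSuccOf b a → P b) : ∀ n, isNat n → P n := by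
  intro n hn
  obtain ⟨I, hI, hI'⟩ := comp_of (M := M) (k := 10) (P := fun x => isNat x ∧ P x)
    (SFm.and strat_auto hP)
  refine ((hI' n).1 (hn I ⟨hI, ?_, ?_⟩)).2
  · intro z hz
    exact (hI' z).2 ⟨nat_zero hz, h0 z hz⟩
  · intro a b ha hb
    have := (hI' a).1 ha
    exact (hI' b).2 ⟨nat_succ this.1 hb, hS a b this.1 this.2 hb⟩

/-- Sets which are empty or equivalence classes under equipollence. -/
def IsCls (c : M) : Prop :=
  sset c ∧ (∀ x y, smem x c → smem y c → equipollent x y) ∧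
    (∀ x y, smem x c → equipollent x y → smem y c)

theorem nat_cls {n : M} (hn : isNat n) : IsCls n := by
  refine nat_ind IsCls strat_auto ?_ ?_ n hn
  · intro z hz
    refine ⟨hz.1, fun x y hx hy => ?_, fun x y hx hxy => ?_⟩
    · rw [hz.2] at hx hy
      exact equip_of_ext fun w => ⟨fun h => (hx w h).elim, fun h => (hy w h).elim⟩
    · rw [hz.2] at hx ⊢
      intro w hw
      obtain ⟨f, hf⟩ := equip_elim hxy
      obtain ⟨a, ha⟩ := hf.surj w hw
      exact hx a (hf.left _ _ ha)
  · intro a b _ ha hb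
    refine ⟨hb.1, fun x y hx hy => ?_, fun x y hx hxy => ?_⟩
    · obtain ⟨z, hz, d, _, hd, hda⟩ := (hb.2 x).1 hx
      obtain ⟨z', hz', d', _, hd', hda'⟩ := (hb.2 y).1 hy
      obtain ⟨s, hs⟩ := ex_sing z
      obtain ⟨s', hs'⟩ := ex_sing z'
      have hss : equipollent s s' := by
        refine equip_mk (fun a b => a = z ∧ b = z') (fun σ => strat_auto) ?_ ?_ ?_ ?_
        · intro a h; exact ⟨z', (hs'.2 _).2 rfl, (hs.2 a).1 h, rfl⟩
        · rintro a b b' - - - ⟨-, rfl⟩ ⟨-, rfl⟩; rfl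
        · rintro a b b' - - - ⟨rfl, -⟩ ⟨rfl, -⟩; rfl
        · intro a h; exact ⟨z, (hs.2 _).2 rfl, rfl, (hs'.2 a).1 h⟩
      refine equip_union (ha.2.1 d d' hda hda') hss ?_ ?_ ?_ ?_
      · rintro w ⟨h1, h2⟩; exact ((hd w).1 h1).2 ((hs.2 w).1 h2)
      · rintro w ⟨h1, h2⟩; exact ((hd' w).1 h1).2 ((hs'.2 w).1 h2)
      · intro w
        rw [hd, hs.2]
        by_cases h : w = z
        · simp [h, hz]
        · simp [h]
      · intro w
        rw [hd', hs'.2]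
        by_cases h : w = z'
        · simp [h, hz']
        · simp [h]
    · obtain ⟨z, hz, d, _, hd, hda⟩ := (hb.2 x).1 hx
      obtain ⟨f, hf⟩ := equip_elim hxy
      obtain ⟨z', hz'⟩ := hf.tot z hz
      obtain ⟨d', hd's, hd'⟩ := ex_diff y z'
      refine (hb.2 y).2 ⟨z', hf.right _ _ hz', d', hd's, hd', ha.2.2 d d' hda ?_⟩
      refine equip_mk (fun a b => smem (spair a b) f) (fun σ => strat_auto) ?_ ?_ ?_ ?_
      · intro a h
        obtain ⟨h1, h2⟩ := (hd a).1 h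
        obtain ⟨b, hb⟩ := hf.tot a h1
        refine ⟨b, (hd' b).2 ⟨hf.right _ _ hb, ?_⟩, hb⟩
        rintro rfl
        exact h2 (hf.inj _ _ _ hb hz')
      · intro a b b' _ _ _ h h'; exact hf.fn _ _ _ h h'
      · intro a b b' _ _ _ h h'; exact hf.inj _ _ _ h h'
      · intro b h
        obtain ⟨h1, h2⟩ := (hd' b).1 h
        obtain ⟨a, ha⟩ := hf.surj b h1
        refine ⟨a, (hd a).2 ⟨hf.left _ _ ha, ?_⟩, ha⟩
        rintro rfl
        exact h2 (hf.fn _ _ _ ha hz')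

theorem nat_eq {a b x : M} (ha : isNat a) (hb : isNat b) (h : smem x a) (h' : smem x b) :
    a = b := by
  have ca := nat_cls ha
  have cb := nat_cls hb
  refine sext ca.1 cb.1 fun z => ⟨fun hz => ?_, fun hz => ?_⟩
  · exact cb.2.2 x z h' (ca.2.1 x z h hz)
  · exact ca.2.2 x z h (cb.2.1 x z h' hz)

theorem card_eq_nat {s t Y : M} (hs : isNat s) (hY : smem Y s) (ht : isCardOf t Y) : t = s := by
  have cs := nat_cls hs
  refine sext ht.1 cs.1 fun z => ?_
  rw [ht.2]
  exact ⟨fun h => cs.2.2 Y z hY (equip_symm h), fun h => cs.2.1 z Y h hY⟩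

theorem nat_isCard {s Y : M} (hs : isNat s) (hY : smem Y s) : isCardOf s Y := by
  have cs := nat_cls hs
  exact ⟨cs.1, fun z => ⟨fun h => cs.2.1 z Y h hY, fun h => cs.2.2 Y z hY (equip_symm h)⟩⟩

theorem zero_ne_succ {z s a : M} (hz : isZeroCard z) (hs : isSuccOf s a)
    (hne : ∃ x, smem x s) : z ≠ s := by
  rintro rfl
  obtain ⟨x, hx⟩ := hne
  obtain ⟨w, hw, _⟩ := (hs.2 x).1 hx
  exact (hz.2 x).1 hx w hw

theorem succ_inj {s a b : M} (ha : isNat a) (hb : isNat b) (hs : isSuccOf s a)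
    (hs' : isSuccOf s b) (hne : ∃ x, smem x s) : a = b := by
  obtain ⟨x, hx⟩ := hne
  obtain ⟨z, hz, d, _, hd, hda⟩ := (hs.2 x).1 hx
  obtain ⟨z', hz', d', _, hd', hdb⟩ := (hs'.2 x).1 hx
  have : equipollent d d' := by
    refine equip_mk (fun p q => (p = q ∧ p ≠ z') ∨ (p = z' ∧ q = z)) (fun σ => strat_auto)
      ?_ ?_ ?_ ?_
    · intro p hp
      rw [hd] at hp
      by_cases h : p = z'
      · refine ⟨z, (hd' z).2 ⟨hz, ?_⟩, Or.inr ⟨h, rfl⟩⟩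
        rintro rfl; exact hp.2 h
      · exact ⟨p, (hd' p).2 ⟨hp.1, h⟩, Or.inl ⟨rfl, h⟩⟩
    · rintro p q q' - - - (⟨rfl, h⟩ | ⟨rfl, rfl⟩) (⟨rfl, h'⟩ | ⟨h'', rfl⟩)
      · rfl
      · exact (h h'').elim
      · exact (h' rfl).elim
      · rfl
    · rintro p p' q hp hp' - (⟨rfl, h⟩ | ⟨rfl, rfl⟩) (⟨rfl, h'⟩ | ⟨rfl, h''⟩)
      · rfl
      · exact (((hd p).1 hp).2 h'').elim
      · exact (((hd p').1 hp').2 rfl).elim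
      · rfl
    · intro q hq
      rw [hd'] at hq
      by_cases h : q = z
      · refine ⟨z', (hd z').2 ⟨hz', ?_⟩, Or.inr ⟨rfl, h⟩⟩
        rintro rfl; exact hq.2 h
      · exact ⟨q, (hd q).2 ⟨hq.1, h⟩, Or.inl ⟨rfl, hq.2⟩⟩
  exact nat_eq ha hb ((nat_cls ha).2.2 d d' hda this) hdb

theorem nat_cases {n : M} (hn : isNat n) : isZeroCard n ∨ ∃ m, isNat m ∧ isSuccOf n m := by
  refine nat_ind (fun n => isZeroCard n ∨ ∃ m, isNat m ∧ isSuccOf n m) strat_auto ?_ ?_ n hn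
  · intro z hz; exact Or.inl hz
  · intro a b ha _ hb; exact Or.inr ⟨a, ha, hb⟩

end Basics

/-- Addition and multiplication are total on the internal natural numbers. -/
class NatTot (M : Type) [LNFU.Structure M] : Prop where
  add : ∀ a b : M, isNat a → isNat b → ∃ c, isNat c ∧ cardAdd a b c
  mul : ∀ a b : M, isNat a → isNat b → ∃ c, isNat c ∧ cardMul a b c

section Arith

variable {M : Type} [LNFU.Structure M] [NFUModel M]

theorem add_mem {a b c x y u : M} (ha : isNat a) (hb : isNat b) (hc : isNat c)
    (h : cardAdd a b c) (hx : smem x a) (hy : smem y b) (hd : ∀ w, ¬ (smem w x ∧ smem w y))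
    (hu : ∀ w, smem w u ↔ (smem w x ∨ smem w y)) : smem u c := by
  obtain ⟨x', y', u', hx', hy', hd', -, hu', h⟩ := h
  exact (nat_cls hc).2.2 u' u h (equip_union ((nat_cls ha).2.1 x' x hx' hx)
    ((nat_cls hb).2.1 y' y hy' hy) hd' hd hu' hu)

theorem mul_mem' {a b c x y u : M} (ha : isNat a) (hb : isNat b) (hc : isNat c)
    (h : cardMul a b c) (hx : smem x a) (hy : smem y b) (hu : isProdOf u x y) : smem u c := by
  obtain ⟨x', y', u', hx', hy', hu', h⟩ := h
  exact (nat_cls hc).2.2 u' u h (equip_prod ((nat_cls ha).2.1 x' x hx' hx)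
    ((nat_cls hb).2.1 y' y hy' hy) hu' hu)

theorem add_uniq {a b c c' : M} (ha : isNat a) (hb : isNat b) (hc : isNat c) (hc' : isNat c')
    (h : cardAdd a b c) (h' : cardAdd a b c') : c = c' := by
  obtain ⟨x, y, u, hx, hy, hd, -, hu, hc1⟩ := h
  exact nat_eq hc hc' hc1 (add_mem ha hb hc' h' hx hy hd hu)

theorem mul_uniq {a b c c' : M} (ha : isNat a) (hb : isNat b) (hc : isNat c) (hc' : isNat c')
    (h : cardMul a b c) (h' : cardMul a b c') : c = c' := by
  obtain ⟨x, y, u, hx, hy, hu, hc1⟩ := h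
  exact nat_eq hc hc' hc1 (mul_mem' ha hb hc' h' hx hy hu)

theorem add_comm' {a b c : M} (h : cardAdd a b c) : cardAdd b a c := by
  obtain ⟨x, y, u, hx, hy, hd, hs, hu, hc⟩ := h
  exact ⟨y, x, u, hy, hx, fun w h => hd w ⟨h.2, h.1⟩, hs, fun w => by rw [hu, or_comm], hc⟩

theorem add_succ_of {a b c b' c' c'' : M} (ha : isNat a) (hb : isNat b) (hc : isNat c)
    (hc'' : isNat c'')
    (h : cardAdd a b c) (hb' : isSuccOf b' b) (hc' : isSuccOf c' c) (h'' : cardAdd a b' c'') :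
    c'' = c' := by
  obtain ⟨x, y', u, hx, hy', hd, hs, hu, huc⟩ := h''
  obtain ⟨z, hz, d, hds, hdd, hdb⟩ := (hb'.2 y').1 hy'
  obtain ⟨v, hv, hvv⟩ := ex_diff u z
  refine nat_eq hc'' (nat_succ hc hc') huc ((hc'.2 u).2 ⟨z, ?_, v, hv, hvv, ?_⟩)
  · exact (hu z).2 (Or.inr hz)
  · refine add_mem ha hb hc h hx hdb ?_ ?_
    · rintro w ⟨h1, h2⟩
      exact hd w ⟨h1, ((hdd w).1 h2).1⟩
    · intro w
      rw [hvv, hu, hdd]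
      constructor
      · rintro ⟨h1 | h1, h2⟩
        · exact Or.inl h1
        · exact Or.inr ⟨h1, h2⟩
      · rintro (h1 | h1)
        · refine ⟨Or.inl h1, ?_⟩
          rintro rfl
          exact hd w ⟨h1, hz⟩
        · exact ⟨Or.inr h1.1, h1.2⟩

variable [NatTot M]

theorem nat_ne {a : M} (ha : isNat a) : ∃ x, smem x a := by
  obtain ⟨c, _, x, _, _, hx, _⟩ := NatTot.add a a ha ha
  exact ⟨x, hx⟩

theorem add_succ' {a b c b' c' : M} (ha : isNat a) (hb : isNat b) (hc : isNat c)
    (h : cardAdd a b c) (hb' : isSuccOf b' b) (hc' : isSuccOf c' c) : cardAdd a b' c' := by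
  obtain ⟨c'', h1, h2⟩ := NatTot.add a b' ha (nat_succ hb hb')
  have := add_succ_of ha hb hc h1 h hb' hc' h2
  subst this
  exact h2

theorem succ_inj' {s a b : M} (ha : isNat a) (hb : isNat b) (hs : isSuccOf s a)
    (hs' : isSuccOf s b) : a = b := succ_inj ha hb hs hs' (nat_ne (nat_succ ha hs))

theorem zero_ne_succ' {s a : M} (ha : isNat a) (hz : isZeroCard s) (hs : isSuccOf s a) : False :=
  zero_ne_succ hz hs (nat_ne (nat_succ ha hs)) rfl

theorem add_zero' {a z : M} (ha : isNat a) (hz : isZeroCard z) : cardAdd a z a := by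
  obtain ⟨x, hx⟩ := nat_ne ha
  obtain ⟨e, he, he'⟩ := ex_empty (M := M)
  obtain ⟨u, hu, hu'⟩ := ex_union x e
  refine ⟨x, e, u, hx, (hz.2 e).2 he', fun w h => he' w h.2, hu, hu', ?_⟩
  refine (nat_cls ha).2.2 x u hx (equip_of_ext fun w => ?_)
  rw [hu']
  exact ⟨Or.inl, fun h => h.elim id fun h => (he' w h).elim⟩

theorem add_zero_eq {a z c : M} (ha : isNat a) (hc : isNat c) (hz : isZeroCard z)
    (h : cardAdd a z c) : c = a :=
  add_uniq ha (nat_zero hz) hc ha h (add_zero' ha hz)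

/-- Splitting a sum with a successor on the right. -/
theorem add_succ_inv {a b' b c : M} (ha : isNat a) (hb : isNat b) (hc : isNat c)
    (hb' : isSuccOf b' b) (h : cardAdd a b' c) :
    ∃ d, isNat d ∧ isSuccOf c d ∧ cardAdd a b d := by
  obtain ⟨d, hd, h1⟩ := NatTot.add a b ha hb
  obtain ⟨s, hs⟩ := ex_succ d
  have := add_uniq ha (nat_succ hb hb') hc (nat_succ hd hs) h (add_succ' ha hb hd h1 hb' hs)
  subst this
  exact ⟨d, hd, hs, h1⟩

theorem add_assoc' : ∀ c : M, isNat c → ∀ a b d e f g, isNat a → isNat b → isNat d → isNat e →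
    isNat f → isNat g → cardAdd a b d → cardAdd d c e → cardAdd b c f → cardAdd a f g → e = g := by
  refine nat_ind (fun c => ∀ a b d e f g, isNat a → isNat b → isNat d → isNat e →
    isNat f → isNat g → cardAdd a b d → cardAdd d c e → cardAdd b c f → cardAdd a f g → e = g)
    strat_auto ?_ ?_
  · intro z hz a b d e f g ha hb hd he hf hg h1 h2 h3 h4
    have e1 := add_zero_eq hd he hz h2
    have e2 := add_zero_eq hb hf hz h3
    subst e1 e2
    exact add_uniq ha hf he hg h1 h4
  · intro c c' hc ih hc' a b d e f g ha hb hd he hf hg h1 h2 h3 h4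
    obtain ⟨e0, he0, hse, h2'⟩ := add_succ_inv hd hc he hc' h2
    obtain ⟨f0, hf0, hsf, h3'⟩ := add_succ_inv hb hc hf hc' h3
    obtain ⟨g0, hg0, hsg, h4'⟩ := add_succ_inv ha hf0 hg hsf h4
    have := ih a b d e0 f0 g0 ha hb hd he0 hf0 hg0 h1 h2' h3' h4'
    subst this
    exact succ_uniq hse hsg

theorem add_self_zero {a k : M} (ha : isNat a) (hk : isNat k) (h : cardAdd a k a) :
    isZeroCard k := by
  by_contra hk0
  refine nat_ind (fun a => ¬ cardAdd a k a) strat_auto ?_ ?_ a ha h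
  · intro z hz h
    have := add_zero_eq hk (nat_zero hz) hz (add_comm' h)
    subst this
    exact hk0 hz
  · intro a b ha ih hb h
    obtain ⟨d, hd, hs, h'⟩ := add_succ_inv hk ha (nat_succ ha hb) hb (add_comm' h)
    have := succ_inj' ha hd hb hs
    subst this
    exact ih (add_comm' h')

theorem add_eq_zero' {a k z : M} (ha : isNat a) (hk : isNat k) (hz : isZeroCard z)
    (h : cardAdd a k z) : isZeroCard k := by
  rcases nat_cases hk with h0 | ⟨k', hk', hs⟩
  · exact h0
  · obtain ⟨d, hd, hs', -⟩ := add_succ_inv ha hk' (nat_zero hz) hs h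
    exact (zero_ne_succ' hd hz hs').elim

/-- The least number principle. -/
theorem least (P : M → Prop) (hP : ∀ σ, SFm (10 :: σ) (fun e => P e.hd)) {n : M} (hn : isNat n)
    (h : P n) : ∃ x, isNat x ∧ P x ∧
      ∀ m k k', isNat m → isNat k' → isSuccOf k k' → cardAdd m k x → ¬ P m := by
  by_contra hcon
  push Not at hcon
  obtain ⟨Q, -, hQ⟩ := comp_of (M := M) (k := 10) (P := P) (hP _)
  have key : ∀ n : M, isNat n → ∀ m k, isNat m → isNat k → cardAdd m k n → ¬ smem m Q := by
    refine nat_ind (fun n => ∀ m k, isNat m → isNat k → cardAdd m k n → ¬ smem m Q)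
      strat_auto ?_ ?_
    · intro z hz m k hm hk hadd hmQ
      have hm0 := add_eq_zero' hk hm hz (add_comm' hadd)
      obtain ⟨m', l, l', h1, h2, h3, h4, h5⟩ := hcon m hm ((hQ m).1 hmQ)
      have := add_eq_zero' h1 (nat_succ h2 h3) hm0 h4
      exact zero_ne_succ' h2 this h3
    · intro a b ha ih hb m k hm hk hadd hmQ
      rcases nat_cases hk with hk0 | ⟨k', hk', hs⟩
      · have := add_zero_eq hm (nat_succ ha hb) hk0 hadd
        subst this
        obtain ⟨m', l, l', h1, h2, h3, h4, h5⟩ := hcon b hm ((hQ b).1 hmQ)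
        obtain ⟨d, hd, hs, h'⟩ := add_succ_inv h1 h2 hm h3 h4
        have := succ_inj' ha hd hb hs
        subst this
        exact ih m' l' h1 h2 h' ((hQ m').2 h5)
      · obtain ⟨d, hd, hs', h'⟩ := add_succ_inv hm hk' (nat_succ ha hb) hs hadd
        have := succ_inj' ha hd hb hs'
        subst this
        exact ih m k' hm hk' h' hmQ
  obtain ⟨z, hz⟩ := ex_zero (M := M)
  exact key n hn n z hn (nat_zero hz) (add_zero' hn hz) ((hQ n).2 h)

end Arith
section TOp

variable {M : Type} [LNFU.Structure M] [NFUModel M]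

theorem iota_mem {X Y s x : M} (h : isIotaImageOf Y X) (hs : isSingletonOf s x) :
    smem s Y ↔ smem x X := by
  rw [h.2]
  constructor
  · rintro ⟨x', h1, h2⟩
    rwa [sing_inj hs h2]
  · intro h1
    exact ⟨x, h1, hs⟩

theorem iota_equip {X X' Y Y' : M} (h : equipollent X X') (hY : isIotaImageOf Y X)
    (hY' : isIotaImageOf Y' X') : equipollent Y Y' := by
  obtain ⟨f, hf⟩ := equip_elim h
  refine equip_mk (fun p q => ∃ a b, isSingletonOf p a ∧ isSingletonOf q b ∧ smem (spair a b) f)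
    (fun σ => strat_auto) ?_ ?_ ?_ ?_
  · intro p hp
    obtain ⟨a, ha, hpa⟩ := (hY.2 p).1 hp
    obtain ⟨b, hb⟩ := hf.tot a ha
    obtain ⟨q, hq⟩ := ex_sing b
    exact ⟨q, (iota_mem hY' hq).2 (hf.right _ _ hb), a, b, hpa, hq, hb⟩
  · rintro p q q' - - - ⟨a, b, h1, h2, h3⟩ ⟨a', b', h1', h2', h3'⟩
    obtain rfl := sing_inj h1 h1'
    obtain rfl := hf.fn _ _ _ h3 h3'
    exact sing_uniq h2 h2'
  · rintro p q q' - - - ⟨a, b, h1, h2, h3⟩ ⟨a', b', h1', h2', h3'⟩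
    obtain rfl := sing_inj h2 h2'
    obtain rfl := hf.inj _ _ _ h3 h3'
    exact sing_uniq h1 h1'
  · intro q hq
    obtain ⟨b, hb, hqb⟩ := (hY'.2 q).1 hq
    obtain ⟨a, ha⟩ := hf.surj b hb
    obtain ⟨p, hp⟩ := ex_sing a
    exact ⟨p, (iota_mem hY hp).2 (hf.left _ _ ha), a, b, hp, hqb, ha⟩

theorem iota_equip_inv {X X' Y Y' : M} (h : equipollent Y Y') (hY : isIotaImageOf Y X)
    (hY' : isIotaImageOf Y' X') : equipollent X X' := by
  obtain ⟨f, hf⟩ := equip_elim h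
  refine equip_mk (fun a b => ∃ p q, isSingletonOf p a ∧ isSingletonOf q b ∧ smem (spair p q) f)
    (fun σ => strat_auto) ?_ ?_ ?_ ?_
  · intro a ha
    obtain ⟨p, hp⟩ := ex_sing a
    obtain ⟨q, hq⟩ := hf.tot p ((iota_mem hY hp).2 ha)
    obtain ⟨b, hb, hqb⟩ := (hY'.2 q).1 (hf.right _ _ hq)
    exact ⟨b, hb, p, q, hp, hqb, hq⟩
  · rintro a b b' - - - ⟨p, q, h1, h2, h3⟩ ⟨p', q', h1', h2', h3'⟩
    obtain rfl := sing_uniq h1 h1'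
    obtain rfl := hf.fn _ _ _ h3 h3'
    exact sing_inj h2 h2'
  · rintro a b b' - - - ⟨p, q, h1, h2, h3⟩ ⟨p', q', h1', h2', h3'⟩
    obtain rfl := sing_uniq h2 h2'
    obtain rfl := hf.inj _ _ _ h3 h3'
    exact sing_inj h1 h1'
  · intro b hb
    obtain ⟨q, hq⟩ := ex_sing b
    obtain ⟨p, hp⟩ := hf.surj q ((iota_mem hY' hq).2 hb)
    obtain ⟨a, ha, hpa⟩ := (hY.2 p).1 (hf.left _ _ hp)
    exact ⟨a, ha, p, q, hpa, hq, hp⟩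

theorem T_mem {t n X Y : M} (hn : isNat n) (h : isTOf t n) (hX : smem X n)
    (hY : isIotaImageOf Y X) : smem Y t := by
  obtain ⟨X', Y', hX', hY', ht⟩ := h
  exact (ht.2 Y).2 (iota_equip ((nat_cls hn).2.1 X X' hX hX') hY hY')

theorem T_of {t n X Y : M} (ht : isNat t) (hX : smem X n)
    (hY : isIotaImageOf Y X) (hYt : smem Y t) : isTOf t n :=
  ⟨X, Y, hX, hY, nat_isCard ht hYt⟩

theorem T_uniq {t t' n : M} (hn : isNat n) (h : isTOf t n) (h' : isTOf t' n) : t = t' := by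
  obtain ⟨X, Y, hX, hY, ht⟩ := h
  obtain ⟨X', Y', hX', hY', ht'⟩ := h'
  have := iota_equip ((nat_cls hn).2.1 X X' hX hX') hY hY'
  refine sext ht.1 ht'.1 fun z => ?_
  rw [ht.2, ht'.2]
  exact ⟨fun h => equip_trans h this, fun h => equip_trans h (equip_symm this)⟩

theorem T_inj {t n m : M} (hn : isNat n) (hm : isNat m) (h : isTOf t n) (h' : isTOf t m) :
    n = m := by
  obtain ⟨X, Y, hX, hY, ht⟩ := h
  obtain ⟨X', Y', hX', hY', ht'⟩ := h'
  have : equipollent Y Y' := (ht'.2 Y).1 ((ht.2 Y).2 (equip_refl Y))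
  exact nat_eq hn hm hX
    ((nat_cls hm).2.2 X' X hX' (equip_symm (iota_equip_inv this hY hY')))

theorem T_zero {z : M} (hz : isZeroCard z) : isTOf z z := by
  obtain ⟨e, he, he'⟩ := ex_empty (M := M)
  obtain ⟨Y, hY⟩ := ex_iota e
  refine T_of (nat_zero hz) ((hz.2 e).2 he') hY ((hz.2 Y).2 fun w hw => ?_)
  obtain ⟨x, hx, -⟩ := (hY.2 w).1 hw
  exact he' x hx

variable [NatTot M]

theorem T_succ {t n t' n' : M} (hn : isNat n) (ht : isNat t) (h : isTOf t n)
    (hn' : isSuccOf n' n) (ht' : isSuccOf t' t) : isTOf t' n' := by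
  obtain ⟨X, hX⟩ := nat_ne (nat_succ hn hn')
  obtain ⟨z, hz, d, _, hd, hda⟩ := (hn'.2 X).1 hX
  obtain ⟨Y, hY⟩ := ex_iota X
  obtain ⟨s, hs⟩ := ex_sing z
  obtain ⟨e, hes, he⟩ := ex_diff Y s
  refine T_of (nat_succ ht ht') hX hY ((ht'.2 Y).2 ⟨s, (iota_mem hY hs).2 hz, e, hes, he, ?_⟩)
  refine T_mem hn h hda ⟨hes, fun p => ?_⟩
  rw [he, hY.2]
  constructor
  · rintro ⟨⟨x, hx, hp⟩, hne⟩
    refine ⟨x, (hd x).2 ⟨hx, ?_⟩, hp⟩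
    rintro rfl
    exact hne (sing_uniq hp hs)
  · rintro ⟨x, hx, hp⟩
    rw [hd] at hx
    refine ⟨⟨x, hx.1, hp⟩, ?_⟩
    rintro rfl
    exact hx.2 (sing_inj hp hs)

theorem T_ex : ∀ n : M, isNat n → ∃ t, isNat t ∧ isTOf t n := by
  refine nat_ind (fun n => ∃ t, isNat t ∧ isTOf t n) strat_auto ?_ ?_
  · intro z hz
    exact ⟨z, nat_zero hz, T_zero hz⟩
  · rintro a b ha ⟨t, ht, h⟩ hb
    obtain ⟨t', ht'⟩ := ex_succ t
    exact ⟨t', nat_succ ht ht', T_succ ha ht h hb ht'⟩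

theorem T_surj : ∀ t : M, isNat t → ∃ n, isNat n ∧ isTOf t n := by
  refine nat_ind (fun t => ∃ n, isNat n ∧ isTOf t n) strat_auto ?_ ?_
  · intro z hz
    exact ⟨z, nat_zero hz, T_zero hz⟩
  · rintro t t' ht ⟨n, hn, h⟩ ht'
    obtain ⟨n', hn'⟩ := ex_succ n
    exact ⟨n', nat_succ hn hn', T_succ hn ht h hn' ht'⟩

theorem T_nat {t n : M} (hn : isNat n) (h : isTOf t n) : isNat t := by
  obtain ⟨t', ht', h'⟩ := T_ex n hn
  rwa [T_uniq hn h h']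

theorem T_one {o : M} (ho : isOneCard o) : isTOf o o := by
  obtain ⟨z, hz, hs⟩ := ho
  exact T_succ (nat_zero hz) (nat_zero hz) (T_zero hz) hs hs

theorem T_add {a b c a' b' c' : M} (ha : isNat a) (hb : isNat b) (hc : isNat c)
    (hc' : isNat c') (h : cardAdd a b c) (Ta : isTOf a' a) (Tb : isTOf b' b)
    (h' : cardAdd a' b' c') : isTOf c' c := by
  obtain ⟨x, y, u, hx, hy, hd, hs, hu, hc1⟩ := h
  obtain ⟨X, hX⟩ := ex_iota x
  obtain ⟨Y, hY⟩ := ex_iota y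
  obtain ⟨U, hU⟩ := ex_iota u
  refine T_of hc' hc1 hU (add_mem (T_nat ha Ta) (T_nat hb Tb) hc' h' (T_mem ha Ta hx hX)
    (T_mem hb Tb hy hY) ?_ ?_)
  · rintro w ⟨h1, h2⟩
    obtain ⟨p, hp, hpw⟩ := (hX.2 w).1 h1
    rw [iota_mem hY hpw] at h2
    exact hd p ⟨hp, h2⟩
  · intro w
    rw [hU.2, hX.2, hY.2]
    constructor
    · rintro ⟨p, hp, hpw⟩
      rcases (hu p).1 hp with h | h
      · exact Or.inl ⟨p, h, hpw⟩
      · exact Or.inr ⟨p, h, hpw⟩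
    · rintro (⟨p, hp, hpw⟩ | ⟨p, hp, hpw⟩)
      · exact ⟨p, (hu p).2 (Or.inl hp), hpw⟩
      · exact ⟨p, (hu p).2 (Or.inr hp), hpw⟩

theorem T_mul {a b c a' b' c' : M} (ha : isNat a) (hb : isNat b) (hc : isNat c)
    (hc' : isNat c') (h : cardMul a b c) (Ta : isTOf a' a) (Tb : isTOf b' b)
    (h' : cardMul a' b' c') : isTOf c' c := by
  obtain ⟨x, y, u, hx, hy, hu, hc1⟩ := h
  obtain ⟨X, hX⟩ := ex_iota x
  obtain ⟨Y, hY⟩ := ex_iota y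
  obtain ⟨U, hU⟩ := ex_iota u
  obtain ⟨P, hP⟩ := ex_prod X Y
  have hPc : smem P c' := mul_mem' (T_nat ha Ta) (T_nat hb Tb) hc' h' (T_mem ha Ta hx hX)
    (T_mem hb Tb hy hY) hP
  refine T_of hc' hc1 hU ((nat_cls hc').2.2 P U hPc ?_)
  refine equip_mk (fun p q => ∃ r s a b, p = spair r s ∧ isSingletonOf r a ∧ isSingletonOf s b ∧
    isSingletonOf q (spair a b)) (fun σ => strat_auto) ?_ ?_ ?_ ?_
  · intro p hp
    obtain ⟨r, s, hr, hs, rfl⟩ := (hP.2 p).1 hp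
    obtain ⟨a, ha, hra⟩ := (hX.2 r).1 hr
    obtain ⟨b, hb, hsb⟩ := (hY.2 s).1 hs
    obtain ⟨q, hq⟩ := ex_sing (spair a b)
    exact ⟨q, (iota_mem hU hq).2 ((hu.2 _).2 ⟨a, b, ha, hb, rfl⟩), r, s, a, b, rfl, hra, hsb, hq⟩
  · rintro p q q' - - - ⟨r, s, a, b, rfl, h1, h2, h3⟩ ⟨r', s', a', b', e, h1', h2', h3'⟩
    obtain ⟨rfl, rfl⟩ := spair_inj e
    obtain rfl := sing_inj h1 h1'
    obtain rfl := sing_inj h2 h2'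
    exact sing_uniq h3 h3'
  · rintro p q q' - - - ⟨r, s, a, b, rfl, h1, h2, h3⟩ ⟨r', s', a', b', rfl, h1', h2', h3'⟩
    obtain ⟨rfl, rfl⟩ := spair_inj (sing_inj h3 h3')
    rw [sing_uniq h1 h1', sing_uniq h2 h2']
  · intro q hq
    obtain ⟨w, hw, hqw⟩ := (hU.2 q).1 hq
    obtain ⟨a, b, ha, hb, rfl⟩ := (hu.2 w).1 hw
    obtain ⟨r, hr⟩ := ex_sing a
    obtain ⟨s, hs⟩ := ex_sing b
    exact ⟨spair r s, (hP.2 _).2 ⟨r, s, (iota_mem hX hr).2 ha, (iota_mem hY hs).2 hb, rfl⟩,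
      r, s, a, b, rfl, hr, hs, hqw⟩

/-- Under `AxCount_≥`, the numbers fixed by `T` are downward closed. -/
theorem T_down (hge : axCountGeqHolds M) {x y : M} (hx : isNat x) (hy : isNat y)
    (h : isTOf x x) (hle : natLe y x) : isTOf y y := by
  obtain ⟨c, hc, hadd⟩ := hle
  obtain ⟨y', hy', Ty⟩ := T_ex y hy
  obtain ⟨c', hc', Tc⟩ := T_ex c hc
  obtain ⟨k, hk, hyk⟩ := hge y hy y' Ty
  obtain ⟨l, hl, hcl⟩ := hge c hc c' Tc
  obtain ⟨x', hx', hadd'⟩ := NatTot.add y' c' hy' hc'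
  have hTx := T_add hy hc hx hx' hadd Ty Tc hadd'
  obtain rfl := T_uniq hx h hTx
  -- now `y' + c' = x`, `y' + k = y`, `c' + l = c`, `y + c = x`
  obtain ⟨p, hp, h1⟩ := NatTot.add k c hk hc
  obtain ⟨q, hq, h2⟩ := NatTot.add y' p hy' hp
  have e1 := add_assoc' c hc y' k y x p q hy' hk hy hx hp hq hyk hadd h1 h2
  subst e1
  -- `p = k + c = c + k = (c' + l) + k = c' + (l + k)`
  obtain ⟨r, hr, h3⟩ := NatTot.add l k hl hk
  obtain ⟨s, hs, h4⟩ := NatTot.add c' r hc' hr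
  have e2 := add_assoc' k hk c' l c p r s hc' hl hc hp hr hs hcl (add_comm' h1) h3 h4
  subst e2
  obtain ⟨v, hv, h5⟩ := NatTot.add x r hx hr
  have e3 := add_assoc' r hr y' c' x v p x hy' hc' hx hv hs hx hadd' h5 h4 h2
  subst e3
  have r0 := add_self_zero hv hr h5
  have k0 := add_eq_zero' hl hk r0 h3
  have := add_zero_eq hy' hy k0 hyk
  subst this
  exact Ty

end TOp
section DefinabilityAux

variable {M : Type} [LNFU.Structure M]

open Classical in
/-- Coerce an element to an internal natural number (with a default value). -/
noncomputable def toN (z : NatSub M) (x : M) : NatSub M :=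
  if h : isNat x then ⟨x, h⟩ else z

theorem toN_of (z : NatSub M) (x : M) (h : isNat x) : toN z x = ⟨x, h⟩ :=
  dif_pos h

theorem toN_of_not (z : NatSub M) (x : M) (h : ¬ isNat x) : toN z x = z :=
  dif_neg h

theorem toN_val (z x : NatSub M) : toN z x.val = x := toN_of z x.val x.2

end DefinabilityAux

section Definability

variable {M : Type} [LNFU.Structure M] [NFUModel M] [A : LPA.Structure (NatSub M)]

theorem def_term (hA : InternalArithOn M A) (z : NatSub M) {n : ℕ}
    (v : Empty → NatSub M) (τ : LPA.Term (Empty ⊕ Fin n)) :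
    ∀ (σ : List ℕ) (t : Fin n → Env M σ → M), (∀ i, STm σ 10 (t i)) →
      SFm (10 :: σ) (fun e =>
        (τ.realize (Sum.elim v (fun i => toN z (t i e.tl)))).val = e.hd) := by
  induction τ with
  | var i =>
    intro σ t ht
    rcases i with i | i
    · exact i.elim
    · refine SFm.congr (P := fun e => ∃ x, x = t i e.tl ∧
        ((isNat x ∧ e.hd = x) ∨ (¬ isNat x ∧ e.hd = z.val))) ?_ ?_
      · refine SFm.ex 10 (SFm.and (SFm.eq (k := 10) STm.v0 (STm.there _ (STm.there _ (ht i)))) ?_)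
        exact strat_auto
      · intro e
        simp only [Term.realize_var, Sum.elim_inr, exists_eq_left]
        by_cases h : isNat (t i e.tl)
        · simp [h, toN_of, eq_comm]
        · simp [h, toN_of_not, eq_comm]
  | func f ts ih =>
    intro σ t ht
    cases f with
    | zero =>
      refine SFm.congr (P := fun e => (A.funMap PAFunc.zero ![]).val = e.hd) strat_auto ?_
      intro e
      have h : (![] : Fin 0 → NatSub M) =
        (fun i => (ts i).realize (Sum.elim v (fun i => toN z (t i e.tl)))) :=
        Subsingleton.elim _ _
      have h' := congrArg (fun w => (A.funMap PAFunc.zero w).val = e.hd) h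
      exact iff_of_eq h'
    | one =>
      refine SFm.congr (P := fun e => (A.funMap PAFunc.one ![]).val = e.hd) strat_auto ?_
      intro e
      have h : (![] : Fin 0 → NatSub M) =
        (fun i => (ts i).realize (Sum.elim v (fun i => toN z (t i e.tl)))) :=
        Subsingleton.elim _ _
      have h' := congrArg (fun w => (A.funMap PAFunc.one w).val = e.hd) h
      exact iff_of_eq h'
    | add =>
      refine SFm.congr (P := fun e => ∃ x,
        ((ts 0).realize (Sum.elim v (fun i => toN z (t i e.tl)))).val = x ∧ ∃ y,
        ((ts 1).realize (Sum.elim v (fun i => toN z (t i e.tl)))).val = y ∧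
        (isNat e.hd ∧ cardAdd x y e.hd)) ?_ ?_
      · refine SFm.ex 10 (SFm.and (ih 0 (10 :: σ) (fun i e => t i e.tl)
          (fun i => STm.there _ (ht i))) ?_)
        refine SFm.ex 10 (SFm.and (ih 1 (10 :: 10 :: σ) (fun i e => t i e.tl.tl)
          (fun i => STm.there _ (STm.there _ (ht i)))) ?_)
        exact strat_auto
      · intro e
        simp only [exists_eq_left']
        let w : Fin 2 → NatSub M :=
          fun i => (ts i).realize (Sum.elim v (fun i => toN z (t i e.tl)))
        change (isNat e.hd ∧ cardAdd (w 0).val (w 1).val e.hd) ↔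
          (A.funMap PAFunc.add w).val = e.hd
        have h2 := hA.2.2.1 (w 0) (w 1)
        have h3 : w = ![w 0, w 1] := by
          funext i
          match i with
          | 0 => rfl
          | 1 => rfl
        rw [← h3] at h2
        constructor
        · rintro ⟨h, h'⟩
          exact add_uniq (w 0).2 (w 1).2 (A.funMap PAFunc.add w).2 h h2 h'
        · intro h
          rw [← h]
          exact ⟨(A.funMap PAFunc.add w).2, h2⟩
    | mul =>
      refine SFm.congr (P := fun e => ∃ x,
        ((ts 0).realize (Sum.elim v (fun i => toN z (t i e.tl)))).val = x ∧ ∃ y,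
        ((ts 1).realize (Sum.elim v (fun i => toN z (t i e.tl)))).val = y ∧
        (isNat e.hd ∧ cardMul x y e.hd)) ?_ ?_
      · refine SFm.ex 10 (SFm.and (ih 0 (10 :: σ) (fun i e => t i e.tl)
          (fun i => STm.there _ (ht i))) ?_)
        refine SFm.ex 10 (SFm.and (ih 1 (10 :: 10 :: σ) (fun i e => t i e.tl.tl)
          (fun i => STm.there _ (STm.there _ (ht i)))) ?_)
        exact strat_auto
      · intro e
        simp only [exists_eq_left']
        let w : Fin 2 → NatSub M :=
          fun i => (ts i).realize (Sum.elim v (fun i => toN z (t i e.tl)))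
        change (isNat e.hd ∧ cardMul (w 0).val (w 1).val e.hd) ↔
          (A.funMap PAFunc.mul w).val = e.hd
        have h2 := hA.2.2.2 (w 0) (w 1)
        have h3 : w = ![w 0, w 1] := by
          funext i
          match i with
          | 0 => rfl
          | 1 => rfl
        rw [← h3] at h2
        constructor
        · rintro ⟨h, h'⟩
          exact mul_uniq (w 0).2 (w 1).2 (A.funMap PAFunc.mul w).2 h h2 h'
        · intro h
          rw [← h]
          exact ⟨(A.funMap PAFunc.mul w).2, h2⟩

theorem def_formula (hA : InternalArithOn M A) (z : NatSub M) {n : ℕ}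
    (v : Empty → NatSub M) (φ : LPA.BoundedFormula Empty n) :
    ∀ (σ : List ℕ) (t : Fin n → Env M σ → M), (∀ i, STm σ 10 (t i)) →
      SFm σ (fun e => φ.Realize v (fun i => toN z (t i e))) := by
  induction φ with
  | falsum => intro σ t ht; exact SFm.fls σ
  | equal τ₁ τ₂ =>
    intro σ t ht
    refine SFm.congr (P := fun e => ∃ x,
      (τ₁.realize (Sum.elim v (fun i => toN z (t i e)))).val = x ∧
      (τ₂.realize (Sum.elim v (fun i => toN z (t i e)))).val = x) ?_ ?_
    · exact SFm.ex 10 (SFm.and (def_term hA z v τ₁ σ t ht) (def_term hA z v τ₂ σ t ht))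
    · intro e
      simp only [exists_eq_left']
      rw [BoundedFormula.Realize]
      exact ⟨fun h => Subtype.ext h.symm, fun h => (congrArg Subtype.val h).symm⟩
  | rel R ts => exact R.elim
  | imp φ ψ ih ih' =>
    intro σ t ht
    exact SFm.imp (ih σ t ht) (ih' σ t ht)
  | @all m φ ih =>
    intro σ t ht
    refine SFm.congr (P := fun e => ∀ x, isNat x → φ.Realize v
      (fun i => toN z ((Fin.snoc (α := fun _ => M) (fun i => t i e) x : Fin (m + 1) → M) i))) ?_ ?_
    · refine SFm.all 10 (SFm.imp strat_auto ?_)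
      refine ih (10 :: σ) (fun i e =>
        (Fin.snoc (α := fun _ => M) (fun i => t i e.tl) e.hd : Fin (m + 1) → M) i) ?_
      intro i
      induction i using Fin.lastCases with
      | last => simpa using STm.v0
      | cast i => simpa using STm.there _ (ht i)
    · intro e
      have key : ∀ x : NatSub M,
          (fun i => toN z ((Fin.snoc (α := fun _ => M) (fun i => t i e) x.val :
            Fin (m + 1) → M) i)) = Fin.snoc (fun i => toN z (t i e)) x := by
        intro x
        funext i
        induction i using Fin.lastCases with
        | last => simp [toN_val]
        | cast i => simp
      rw [BoundedFormula.Realize]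
      constructor
      · intro h x
        rw [← key x]
        exact h x.val x.2
      · intro h x hx
        have := key ⟨x, hx⟩
        simp only at this
        rw [this]
        exact h ⟨x, hx⟩

end Definability
section Final

variable {M : Type} [LNFU.Structure M] [NFUModel M] [NatTot M]

/-- The operation `T` on the internal natural numbers. -/
noncomputable def Tmap (n : NatSub M) : NatSub M :=
  ⟨(T_ex n.1 n.2).choose, (T_ex n.1 n.2).choose_spec.1⟩

theorem Tmap_spec (n : NatSub M) : isTOf (Tmap n).val n.val := (T_ex n.1 n.2).choose_spec.2

theorem Tmap_eq {n m : NatSub M} (h : isTOf m.val n.val) : Tmap n = m :=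
  Subtype.ext (T_uniq n.2 (Tmap_spec n) h)

theorem Tmap_bij : Function.Bijective (Tmap (M := M)) := by
  constructor
  · intro a b h
    have h1 := Tmap_spec a
    have h2 := Tmap_spec b
    rw [← h] at h2
    exact Subtype.ext (T_inj a.2 b.2 h1 h2)
  · intro t
    obtain ⟨n, hn, h⟩ := T_surj t.1 t.2
    exact ⟨⟨n, hn⟩, Tmap_eq h⟩

theorem vec2_eta {α : Type} (w : Fin 2 → α) : w = ![w 0, w 1] := by
  funext i
  match i with
  | 0 => rfl
  | 1 => rfl

/-- `T` is an automorphism of the internal arithmetic. -/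
noncomputable def Taut (A : LPA.Structure (NatSub M)) (hA : InternalArithOn M A) :
    NatSub M ≃[LPA] NatSub M where
  toEquiv := Equiv.ofBijective Tmap Tmap_bij
  map_fun' := by
    intro n f x
    change Tmap (A.funMap f x) = A.funMap f (Tmap ∘ x)
    cases f with
    | zero =>
      have h1 : x = ![] := Subsingleton.elim _ _
      have h2 : Tmap ∘ x = ![] := Subsingleton.elim _ _
      rw [h2, h1]
      exact Tmap_eq (T_zero hA.1)
    | one =>
      have h1 : x = ![] := Subsingleton.elim _ _
      have h2 : Tmap ∘ x = ![] := Subsingleton.elim _ _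
      rw [h2, h1]
      exact Tmap_eq (T_one hA.2.1)
    | add =>
      have h1 := hA.2.2.1 (x 0) (x 1)
      have h2 := hA.2.2.1 (Tmap (x 0)) (Tmap (x 1))
      rw [vec2_eta (Tmap ∘ x), vec2_eta x]
      exact Tmap_eq (T_add (x 0).2 (x 1).2 (A.funMap PAFunc.add ![x 0, x 1]).2
        (A.funMap PAFunc.add ![Tmap (x 0), Tmap (x 1)]).2 h1 (Tmap_spec _) (Tmap_spec _) h2)
    | mul =>
      have h1 := hA.2.2.2 (x 0) (x 1)
      have h2 := hA.2.2.2 (Tmap (x 0)) (Tmap (x 1))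
      rw [vec2_eta (Tmap ∘ x), vec2_eta x]
      exact Tmap_eq (T_mul (x 0).2 (x 1).2 (A.funMap PAFunc.mul ![x 0, x 1]).2
        (A.funMap PAFunc.mul ![Tmap (x 0), Tmap (x 1)]).2 h1 (Tmap_spec _) (Tmap_spec _) h2)
  map_rel' := by
    intro n r x
    exact r.elim

/-- The Tarski-Vaught property: definable sets with fixed parameters have fixed members. -/
theorem tv_key (hge : axCountGeqHolds M) (A : LPA.Structure (NatSub M))
    (hA : InternalArithOn M A) (n : ℕ) (φ : LPA.BoundedFormula Empty (n + 1))
    (p : Fin n → NatSub M) (hp : ∀ i, isTOf (p i).val (p i).val) (a : NatSub M)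
    (ha : φ.Realize default (Fin.snoc p a : Fin (n + 1) → NatSub M)) :
    ∃ b : NatSub M, isTOf b.val b.val ∧
      φ.Realize default (Fin.snoc p b : Fin (n + 1) → NatSub M) := by
  have key : ∀ x : NatSub M,
      (fun i => toN a ((Fin.snoc (α := fun _ => M) (fun i => (p i).val) x.val :
        Fin (n + 1) → M) i)) = Fin.snoc p x := by
    intro x
    funext i
    induction i using Fin.lastCases with
    | last => simp [toN_val]
    | cast i => simp [toN_val]
  let P : M → Prop := fun x => φ.Realize default
    (fun i => toN a ((Fin.snoc (α := fun _ => M) (fun i => (p i).val) x : Fin (n + 1) → M) i))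
  have hPval : ∀ x : NatSub M, P x.val ↔ φ.Realize default (Fin.snoc p x : Fin (n + 1) → NatSub M) := by
    intro x
    change φ.Realize default _ ↔ _
    rw [key x]
  have hP : ∀ σ, SFm (10 :: σ) (fun e => P e.hd) := by
    intro σ
    refine def_formula hA a default φ (10 :: σ) (fun i e =>
        (Fin.snoc (α := fun _ => M) (fun i => (p i).val) e.hd : Fin (n + 1) → M) i) ?_
    intro i
    induction i using Fin.lastCases with
    | last => simpa using STm.v0
    | cast i => simpa using STm.const _ _ _
  obtain ⟨x, hx, hPx, hmin⟩ := least P hP a.2 ((hPval a).2 ha)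
  let X : NatSub M := ⟨x, hx⟩
  have hX : φ.Realize default (Fin.snoc p X : Fin (n + 1) → NatSub M) := (hPval X).1 hPx
  have hTX : φ.Realize default (Fin.snoc p (Tmap X) : Fin (n + 1) → NatSub M) := by
    have h := (StrongHomClass.realize_boundedFormula (Taut A hA) φ).2 hX
    have e1 : (Taut A hA ∘ (Fin.snoc p X : Fin (n + 1) → NatSub M)) = Fin.snoc p (Tmap X) := by
      funext i
      change Tmap ((Fin.snoc p X : Fin (n + 1) → NatSub M) i) = _
      induction i using Fin.lastCases with
      | last => simp
      | cast i => simpa using Tmap_eq (hp i)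
    rw [e1] at h
    convert h
  obtain ⟨k, hk, hadd⟩ := hge x hx (Tmap X).val (Tmap_spec X)
  rcases nat_cases hk with h0 | ⟨k', hk', hs⟩
  · have e := add_zero_eq (Tmap X).2 hx h0 hadd
    refine ⟨X, ?_, hX⟩
    have := Tmap_spec X
    rw [← e] at this
    exact this
  · exact (hmin (Tmap X).val k k' (Tmap X).2 hk' hs hadd ((hPval _).2 hTX)).elim

end Final
theorem stmt9 :
    ∀ (M : Type) [LNFU.Structure M] [Nonempty M], M ⊨ NFUmAC →
      axCountGeqHolds M → ¬ axCountHolds M →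
      ∀ A : LPA.Structure (NatSub M), InternalArithOn M A →
        isTOf (A.funMap PAFunc.zero ![]).val (A.funMap PAFunc.zero ![]).val ∧
        isTOf (A.funMap PAFunc.one ![]).val (A.funMap PAFunc.one ![]).val ∧
        (∀ a b : NatSub M, isTOf a.val a.val → isTOf b.val b.val →
          isTOf (A.funMap PAFunc.add ![a, b]).val (A.funMap PAFunc.add ![a, b]).val) ∧
        (∀ a b : NatSub M, isTOf a.val a.val → isTOf b.val b.val →
          isTOf (A.funMap PAFunc.mul ![a, b]).val (A.funMap PAFunc.mul ![a, b]).val) ∧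
        ∀ S : @Substructure LPA (NatSub M) A,
          (∀ x : NatSub M, x ∈ S ↔ isTOf x.val x.val) →
            S ≠ ⊤ ∧ @Substructure.IsElementary LPA (NatSub M) A S ∧
              (∀ x y : NatSub M, x ∈ S → natLe y.val x.val → y ∈ S) := by
  intro M _ _ hM hge hnc A hA
  haveI : NFUModel M := ⟨hM⟩
  haveI : NatTot M :=
    ⟨fun a b ha hb => ⟨_, (A.funMap PAFunc.add ![⟨a, ha⟩, ⟨b, hb⟩]).2, hA.2.2.1 ⟨a, ha⟩ ⟨b, hb⟩⟩,
     fun a b ha hb => ⟨_, (A.funMap PAFunc.mul ![⟨a, ha⟩, ⟨b, hb⟩]).2, hA.2.2.2 ⟨a, ha⟩ ⟨b, hb⟩⟩⟩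
  refine ⟨T_zero hA.1, T_one hA.2.1, ?_, ?_, ?_⟩
  · intro a b ha hb
    have h := hA.2.2.1 a b
    exact T_add a.2 b.2 (A.funMap PAFunc.add ![a, b]).2 (A.funMap PAFunc.add ![a, b]).2 h ha hb h
  · intro a b ha hb
    have h := hA.2.2.2 a b
    exact T_mul a.2 b.2 (A.funMap PAFunc.mul ![a, b]).2 (A.funMap PAFunc.mul ![a, b]).2 h ha hb h
  · intro S hS
    refine ⟨?_, ?_, ?_⟩
    · rintro rfl
      refine hnc fun n hn t ht => ?_
      have h := (hS ⟨n, hn⟩).1 (Substructure.mem_top _)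
      exact T_uniq hn ht h
    · refine Substructure.isElementary_of_exists S ?_
      intro n φ x a ha
      obtain ⟨b, hb, hb'⟩ := tv_key hge A hA n φ (fun i => (x i).1)
        (fun i => (hS _).1 (x i).2) a ha
      exact ⟨⟨b, (hS b).2 hb⟩, hb'⟩
    · intro x y hx hle
      rw [hS] at hx ⊢
      exact T_down hge x.2 y.2 hx hle

end NFUweak
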